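/- If G is a minimal counterexample, then G has no vertex of degree 2; that is, every vertex of G has degree exactly 3. -/

import Mathlib

open SimpleGraph

/-- A `(1,2^k)`-packing edge-coloring encoded as a function assigning a color in
`Fin (k+1)` to each unordered pair. Color `0` is the 1-color (its class must be a
matching) and each color `i ≠ 0` is a 2-color (its class must be an induced matching). -/
def IsPackingEC {V : Type} (G : SimpleGraph V) (k : ℕ)
    (c : Sym2 V → Fin (k + 1)) : Prop :=
  (∀ a b x y : V, G.Adj a b → G.Adj x y → s(a, b) ≠ s(x, y) →
      c s(a, b) = 0 → c s(x, y) = 0 →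
      a ≠ x ∧ a ≠ y ∧ b ≠ x ∧ b ≠ y) ∧
  ∀ a b x y : V, G.Adj a b → G.Adj x y → s(a, b) ≠ s(x, y) →
      c s(a, b) = c s(x, y) → c s(a, b) ≠ 0 →
      (a ≠ x ∧ a ≠ y ∧ b ≠ x ∧ b ≠ y) ∧
      ¬G.Adj a x ∧ ¬G.Adj a y ∧ ¬G.Adj b x ∧ ¬G.Adj b y

/-- A good coloring: a `(1,2^7)`-packing edge-coloring in which every edge of the
1-color class (color `0`) has both endpoints of degree 3. -/
def GoodColoring {V : Type} (G : SimpleGraph V) (c : Sym2 V → Fin 8) : Prop :=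
  IsPackingEC G 7 c ∧
  ∀ a b : V, G.Adj a b → c s(a, b) = 0 →
    (G.neighborSet a).ncard = 3 ∧ (G.neighborSet b).ncard = 3

/-- A graph is subcubic if every vertex has degree at most 3. -/
def Subcubic {V : Type} (G : SimpleGraph V) : Prop :=
  ∀ v : V, (G.neighborSet v).ncard ≤ 3

/-- A minimal counterexample: a finite subcubic simple graph with no good coloring such
that every finite subcubic simple graph with smaller `|V| + |E|` has a good coloring. -/
def MinCounter (V : Type) [Finite V] (G : SimpleGraph V) : Prop :=
  Subcubic G ∧
  (¬∃ c : Sym2 V → Fin 8, GoodColoring G c) ∧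
  ∀ (W : Type) [Finite W] (H : SimpleGraph W), Subcubic H →
    Nat.card W + H.edgeSet.ncard < Nat.card V + G.edgeSet.ncard →
    ∃ c : Sym2 W → Fin 8, GoodColoring H c

section Coloring

variable {V : Type}

/-- A coloring of the edges in `E` that satisfies the constraints of a good coloring of `G`,
where distances and degrees are measured in `G`. -/
def PartialGood (G : SimpleGraph V) (E : Set (Sym2 V)) (c : Sym2 V → Fin 8) : Prop :=
  (∀ e ∈ E, ∀ f ∈ E, e ≠ f → c e = 0 → c f = 0 → ∀ a ∈ e, a ∉ f) ∧
  (∀ e ∈ E, ∀ f ∈ E, e ≠ f → c e = c f → c e ≠ 0 → ∀ a ∈ e, ∀ b ∈ f, a ≠ b ∧ ¬G.Adj a b) ∧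
  ∀ e ∈ E, c e = 0 → ∀ a ∈ e, (G.neighborSet a).ncard = 3

/-- The nonzero colors of the edges of `E` at the vertex `z`. -/
def colorsAt (E : Set (Sym2 V)) (c : Sym2 V → Fin 8) (z : V) : Set (Fin 8) :=
  {i | i ≠ 0 ∧ ∃ e ∈ E, z ∈ e ∧ c e = i}

/-- The nonzero colors of the edges of `E` at the neighbors of `x` other than `y`. -/
def colorsNear (G : SimpleGraph V) (E : Set (Sym2 V)) (c : Sym2 V → Fin 8) (x y : V) :
    Set (Fin 8) :=
  ⋃ z ∈ G.neighborSet x \ {y}, colorsAt E c z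

/-- The edges of `E` at the vertex `z`. -/
def edgesAt (E : Set (Sym2 V)) (z : V) : Set (Sym2 V) :=
  {e | e ∈ E ∧ z ∈ e}

theorem goodColoring_iff_partialGood {G : SimpleGraph V} {c : Sym2 V → Fin 8} :
    GoodColoring G c ↔ PartialGood G G.edgeSet c := by
  constructor
  · rintro ⟨⟨h₁, h₂⟩, h₃⟩
    refine ⟨fun e he f hf hne h0 h0' a ha haf => ?_, fun e he f hf hne hc h0 a ha b hb => ?_,
      fun e he h0 a ha => ?_⟩
    · obtain ⟨b, rfl⟩ := ha
      obtain ⟨b', rfl⟩ := haf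
      exact (h₁ a b a b' he hf hne h0 h0').1 rfl
    · obtain ⟨a', rfl⟩ := ha
      obtain ⟨b', rfl⟩ := hb
      have := h₂ a a' b b' he hf hne hc h0
      exact ⟨this.1.1, this.2.1⟩
    · obtain ⟨b, rfl⟩ := ha
      exact (h₃ a b he h0).1
  · rintro ⟨h₁, h₂, h₃⟩
    refine ⟨⟨fun a b x y hab hxy hne h0 h0' => ?_, fun a b x y hab hxy hne hc h0 => ?_⟩,
      fun a b hab h0 => ?_⟩
    · have h := h₁ _ hab _ hxy hne h0 h0'
      have ha := h a (by simp)
      have hb := h b (by simp)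
      simp only [Sym2.mem_iff, not_or] at ha hb
      exact ⟨ha.1, ha.2, hb.1, hb.2⟩
    · have h := h₂ _ hab _ hxy hne hc h0
      have h1 := h a (by simp) x (by simp)
      have h2 := h a (by simp) y (by simp)
      have h3 := h b (by simp) x (by simp)
      have h4 := h b (by simp) y (by simp)
      exact ⟨⟨h1.1, h2.1, h3.1, h4.1⟩, h1.2, h2.2, h3.2, h4.2⟩
    · exact ⟨h₃ _ hab h0 a (by simp), h₃ _ hab h0 b (by simp)⟩

theorem mem_colorsNear {G : SimpleGraph V} {E : Set (Sym2 V)} {c : Sym2 V → Fin 8} {x y z : V}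
    {f : Sym2 V} (hz : G.Adj x z) (hzy : z ≠ y) (hf : f ∈ E) (hzf : z ∈ f) (h0 : c f ≠ 0) :
    c f ∈ colorsNear G E c x y :=
  Set.mem_biUnion (x := z) ⟨hz, hzy⟩ ⟨h0, f, hf, hzf, rfl⟩

/-- The color of an edge of `E` that shares a vertex with `s(x, y)`, or is joined to it by an
edge, occurs near `x` or near `y`. -/
theorem mem_colorsNear_or {G : SimpleGraph V} {E : Set (Sym2 V)} {c : Sym2 V → Fin 8} {x y : V}
    (hE : E ⊆ G.edgeSet) (he : s(x, y) ∉ E) {f : Sym2 V} (hf : f ∈ E) (h0 : c f ≠ 0)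
    {a b : V} (ha : a ∈ s(x, y)) (hb : b ∈ f) (hab : a = b ∨ G.Adj a b) :
    c f ∈ colorsNear G E c x y ∪ colorsNear G E c y x := by
  have key : ∀ x y : V, s(x, y) ∉ E → x ∈ f → c f ∈ colorsNear G E c x y := by
    intro x y he hx
    obtain ⟨z, rfl⟩ := hx
    refine mem_colorsNear (z := z) (hE hf) ?_ hf (by simp) h0
    rintro rfl
    exact he hf
  have key' : ∀ x y : V, s(x, y) ∉ E → G.Adj x b →
      c f ∈ colorsNear G E c x y ∪ colorsNear G E c y x := by
    intro x y he hx
    by_cases hby : b = y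
    · subst hby
      exact Or.inr (key _ _ (by rwa [Sym2.eq_swap]) hb)
    · exact Or.inl (mem_colorsNear hx hby hf hb h0)
  have he' : s(y, x) ∉ E := by rwa [Sym2.eq_swap]
  rcases Sym2.mem_iff.1 ha with rfl | rfl
  · rcases hab with rfl | hab
    · exact Or.inl (key _ _ he hb)
    · exact key' _ _ he hab
  · rcases hab with rfl | hab
    · exact Or.inr (key _ _ he' hb)
    · exact (key' _ _ he' hab).symm

theorem PartialGood.insert_edge [DecidableEq V] {G : SimpleGraph V} {E : Set (Sym2 V)}
    {c : Sym2 V → Fin 8} {x y : V} {i : Fin 8} (h : PartialGood G E c) (hE : E ⊆ G.edgeSet)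
    (he : s(x, y) ∉ E) (hi : i ≠ 0)
    (hx : i ∉ colorsNear G E c x y) (hy : i ∉ colorsNear G E c y x) :
    PartialGood G (insert s(x, y) E) (Function.update c s(x, y) i) := by
  have hne : ∀ f ∈ E, Function.update c s(x, y) i f = c f := fun f hf =>
    Function.update_of_ne (by rintro rfl; exact he hf) _ _
  have hnear : ∀ f ∈ E, c f = i → ∀ a ∈ s(x, y), ∀ b ∈ f, a ≠ b ∧ ¬G.Adj a b := by
    intro f hf hc a ha b hb
    by_contra hab
    have := mem_colorsNear_or (c := c) hE he hf (hc ▸ hi) ha hb (by tauto)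
    rw [hc] at this
    exact this.elim hx hy
  obtain ⟨h₁, h₂, h₃⟩ := h
  refine ⟨?_, ?_, ?_⟩
  · rintro e (rfl | hee) f (rfl | hff) hef h0 h0'
    · exact absurd rfl hef
    · simp [hi] at h0
    · simp [hi] at h0'
    · rw [hne _ hee] at h0
      rw [hne _ hff] at h0'
      exact h₁ e hee f hff hef h0 h0'
  · rintro e (rfl | hee) f (rfl | hff) hef hc h0 a ha b hb
    · exact absurd rfl hef
    · rw [hne _ hff, Function.update_self] at hc
      exact hnear f hff hc.symm a ha b hb
    · rw [hne _ hee, Function.update_self] at hc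
      have := hnear e hee hc b hb a ha
      exact ⟨this.1.symm, fun h => this.2 h.symm⟩
    · rw [hne _ hee] at h0
      rw [hne _ hff, hne _ hee] at hc
      exact h₂ e hee f hff hef hc h0 a ha b hb
  · rintro e (rfl | hee) h0
    · simp [hi] at h0
    · rw [hne _ hee] at h0
      exact h₃ e hee h0

theorem colorsAt_ncard_le [Finite V] {E : Set (Sym2 V)} {c : Sym2 V → Fin 8} {z : V} :
    (colorsAt E c z).ncard ≤ {e | e ∈ E ∧ z ∈ e ∧ c e ≠ 0}.ncard := by
  have : colorsAt E c z ⊆ c '' {e | e ∈ E ∧ z ∈ e ∧ c e ≠ 0} := by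
    rintro i ⟨hi, e, he, hz, rfl⟩
    exact ⟨e, ⟨he, hz, hi⟩, rfl⟩
  exact (Set.ncard_le_ncard this).trans (Set.ncard_image_le)

theorem colorsAt_ncard_le_edgesAt [Finite V] {E F : Set (Sym2 V)} (hEF : ∀ e ∈ E, e ∈ F ∨ c e = 0)
    {z : V} : (colorsAt E c z).ncard ≤ (edgesAt F z).ncard :=
  colorsAt_ncard_le.trans (Set.ncard_le_ncard fun e he =>
    ⟨(hEF e he.1).resolve_right he.2.2, he.2.1⟩)

theorem edgesAt_edgeSet_ncard [Finite V] (G : SimpleGraph V) (z : V) :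
    (edgesAt G.edgeSet z).ncard = (G.neighborSet z).ncard := by
  classical
  exact Nat.card_congr (G.incidenceSetEquivNeighborSet z)

theorem edgesAt_ncard_le [Finite V] {G : SimpleGraph V} {E : Set (Sym2 V)} (hE : E ⊆ G.edgeSet)
    (z : V) : (edgesAt E z).ncard ≤ (G.neighborSet z).ncard := by
  rw [← edgesAt_edgeSet_ncard]
  exact Set.ncard_le_ncard fun e he => ⟨hE he.1, he.2⟩

theorem edgesAt_ncard_lt [Finite V] {G : SimpleGraph V} {E : Set (Sym2 V)} (hE : E ⊆ G.edgeSet)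
    {z : V} {e : Sym2 V} (he : e ∈ G.edgeSet) (hz : z ∈ e) (hne : e ∉ E) :
    (edgesAt E z).ncard < (G.neighborSet z).ncard := by
  rw [← edgesAt_edgeSet_ncard]
  refine Set.ncard_lt_ncard ⟨fun e he => ⟨hE he.1, he.2⟩, fun h => ?_⟩
  exact hne (h ⟨he, hz⟩).1

theorem colorsNear_ncard_le [Finite V] {G : SimpleGraph V} {E : Set (Sym2 V)}
    {c : Sym2 V → Fin 8} {x y : V} {s : Set V} {k n : ℕ} (hs : s.ncard ≤ n)
    (h0 : ∀ z, G.Adj x z → z ≠ y → z ∉ s → colorsAt E c z = ∅)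
    (hk : ∀ z ∈ s, (colorsAt E c z).ncard ≤ k) :
    (colorsNear G E c x y).ncard ≤ n * k := by
  classical
  have hsub : colorsNear G E c x y ⊆ ⋃ z ∈ s, colorsAt E c z := by
    intro i hi
    simp only [colorsNear, Set.mem_iUnion] at hi ⊢
    obtain ⟨z, hz, hi⟩ := hi
    by_cases hzs : z ∈ s
    · exact ⟨z, hzs, hi⟩
    · rw [h0 z hz.1 hz.2 hzs] at hi
      exact hi.elim
  refine (Set.ncard_le_ncard hsub).trans ?_
  have hfin : s.Finite := s.toFinite
  have := hfin.toFinset.set_ncard_biUnion_le (fun z => colorsAt E c z)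
  simp only [Set.Finite.mem_toFinset] at this
  refine this.trans ((Finset.sum_le_card_nsmul _ _ k (by simpa using hk)).trans ?_)
  rw [← Set.ncard_eq_toFinset_card s hfin, smul_eq_mul]
  exact Nat.mul_le_mul_right k hs

theorem neighborSet_diff_ncard [Finite V] {G : SimpleGraph V} {x y : V} (h : G.Adj x y) :
    (G.neighborSet x \ {y}).ncard + 1 = (G.neighborSet x).ncard :=
  Set.ncard_sdiff_singleton_add_one h

theorem colorsNear_ncard_le_mul [Finite V] {G : SimpleGraph V} {E : Set (Sym2 V)}
    {c : Sym2 V → Fin 8} {x y : V} (hxy : G.Adj x y) {k n : ℕ}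
    (hx : (G.neighborSet x).ncard ≤ n + 1)
    (hk : ∀ z, G.Adj x z → z ≠ y → (colorsAt E c z).ncard ≤ k) :
    (colorsNear G E c x y).ncard ≤ n * k := by
  have := neighborSet_diff_ncard hxy
  exact colorsNear_ncard_le (s := G.neighborSet x \ {y}) (by omega)
    (fun z h h' h'' => absurd ⟨h, h'⟩ h'') fun z hz => hk z hz.1 hz.2

/-- The nonzero colors outside a set. -/
def freeColors (s : Set (Fin 8)) : Set (Fin 8) := {i | i ≠ 0 ∧ i ∉ s}

theorem le_freeColors_ncard (s : Set (Fin 8)) : 7 ≤ (freeColors s).ncard + s.ncard := by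
  have h1 : ({0}ᶜ : Set (Fin 8)) ⊆ freeColors s ∪ s := by
    intro i hi
    by_cases h : i ∈ s
    · exact Or.inr h
    · exact Or.inl ⟨hi, h⟩
  have h2 : ({0}ᶜ : Set (Fin 8)).ncard = 7 := by
    rw [Set.ncard_compl]; simp
  have := Set.ncard_le_ncard h1
  have := Set.ncard_union_le (freeColors s) s
  omega

theorem exists_color {s t : Set (Fin 8)} (h : s.ncard + t.ncard ≤ 6) :
    ∃ i, i ≠ 0 ∧ i ∉ s ∧ i ∉ t := by
  have h1 := Set.ncard_union_le s t
  have h2 := le_freeColors_ncard (s ∪ t)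
  obtain ⟨i, hi⟩ := Set.nonempty_of_ncard_ne_zero (s := freeColors (s ∪ t)) (by omega)
  exact ⟨i, hi.1, fun h => hi.2 (Or.inl h), fun h => hi.2 (Or.inr h)⟩

end Coloring

section Deletion

variable {V : Type} {G : SimpleGraph V}

theorem edgeSet_fromEdgeSet_of_subset {E : Set (Sym2 V)} (hE : E ⊆ G.edgeSet) :
    (fromEdgeSet E).edgeSet = E := by
  rw [edgeSet_fromEdgeSet, sdiff_eq_left, Set.disjoint_left]
  exact fun e he => G.not_isDiag_of_mem_edgeSet (hE he)

theorem neighborSet_fromEdgeSet_subset {E : Set (Sym2 V)} (hE : E ⊆ G.edgeSet) (v : V) :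
    (fromEdgeSet E).neighborSet v ⊆ G.neighborSet v := fun _ h => hE h.1

/-- The edges of `G` with no end in `Y`. -/
def edgesAvoiding (G : SimpleGraph V) (Y : Set V) : Set (Sym2 V) :=
  {e | e ∈ G.edgeSet ∧ ∀ y ∈ Y, y ∉ e}

theorem edgesAvoiding_subset {Y : Set V} : edgesAvoiding G Y ⊆ G.edgeSet := fun _ h => h.1

variable [Finite V]

theorem MinCounter.exists_partialGood (hG : MinCounter V G) {E : Set (Sym2 V)}
    (hE : E ⊂ G.edgeSet) :
    ∃ c, PartialGood (fromEdgeSet E) E c := by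
  obtain ⟨c, hc⟩ := hG.2.2 V (fromEdgeSet E)
    (fun v => (Set.ncard_le_ncard (neighborSet_fromEdgeSet_subset hE.1 v)).trans (hG.1 v)) (by
      rw [edgeSet_fromEdgeSet_of_subset hE.1]
      have := Set.ncard_lt_ncard hE
      omega)
  rw [goodColoring_iff_partialGood, edgeSet_fromEdgeSet_of_subset hE.1] at hc
  exact ⟨c, hc⟩

theorem MinCounter.not_partialGood (hG : MinCounter V G) (c : Sym2 V → Fin 8) :
    ¬PartialGood G G.edgeSet c :=
  fun h => hG.2.1 ⟨c, goodColoring_iff_partialGood.2 h⟩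

/-- Deleting the edges at the vertices of `Y` creates no new conflicts among the other edges. -/
theorem MinCounter.exists_partialGood_edgesAvoiding (hG : MinCounter V G) {Y : Set V} {y z : V}
    (hy : y ∈ Y) (hyz : G.Adj y z) : ∃ c, PartialGood G (edgesAvoiding G Y) c := by
  obtain ⟨c, h₁, h₂, h₃⟩ := hG.exists_partialGood (E := edgesAvoiding G Y)
    ⟨edgesAvoiding_subset, fun h => (h (a := s(y, z)) hyz).2 y hy (by simp)⟩
  refine ⟨c, h₁, fun e he f hf hne hc h0 a ha b hb => ?_, fun e he h0 a ha => ?_⟩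
  · have := h₂ e he f hf hne hc h0 a ha b hb
    refine ⟨this.1, fun hab => this.2 ⟨⟨hab, ?_⟩, this.1⟩⟩
    intro y hy hyab
    rcases Sym2.mem_iff.1 hyab with rfl | rfl
    · exact he.2 _ hy ha
    · exact hf.2 _ hy hb
  · refine le_antisymm (hG.1 a) ?_
    rw [← h₃ e he h0 a ha]
    exact Set.ncard_le_ncard (neighborSet_fromEdgeSet_subset edgesAvoiding_subset a)

theorem MinCounter.exists_adj (hG : MinCounter V G) (v : V) : ∃ u, G.Adj v u := by
  classical
  by_contra! hv
  have hE : (G.induce {v}ᶜ).edgeSet.ncard ≤ G.edgeSet.ncard := by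
    refine Set.ncard_le_ncard_of_injOn (Sym2.map Subtype.val) ?_
      (Sym2.map.injective Subtype.val_injective).injOn
    intro e
    induction e with
    | h a b => exact fun h => h
  have hcard : Nat.card ({v}ᶜ : Set V) < Nat.card V := by
    rw [← Set.ncard_univ V, Nat.card_coe_set_eq]
    exact Set.ncard_lt_ncard ⟨Set.subset_univ _, fun h => h (Set.mem_univ v) rfl⟩
  have hnb : ∀ w : ({v}ᶜ : Set V),
      ((G.induce {v}ᶜ).neighborSet w).ncard = (G.neighborSet w).ncard := by
    intro w
    rw [← Set.ncard_image_of_injective _ Subtype.val_injective]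
    congr 1
    ext u
    constructor
    · rintro ⟨u, hu, rfl⟩
      exact hu
    · intro hu
      have huv : u ≠ v := by
        rintro rfl
        exact hv _ hu.symm
      exact ⟨⟨u, huv⟩, hu, rfl⟩
  obtain ⟨c, hc⟩ := hG.2.2 ({v}ᶜ : Set V) (G.induce {v}ᶜ) (fun w => (hnb w).trans_le (hG.1 w))
    (by omega)
  have hinj : Function.Injective (Sym2.map (Subtype.val : ({v}ᶜ : Set V) → V)) :=
    Sym2.map.injective Subtype.val_injective
  have hlift : ∀ {a b}, G.Adj a b → ∃ (a' b' : ({v}ᶜ : Set V)), a'.1 = a ∧ b'.1 = b := by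
    intro a b hab
    exact ⟨⟨a, by rintro rfl; exact hv _ hab⟩, ⟨b, by rintro rfl; exact hv _ hab.symm⟩, rfl, rfl⟩
  have hext : ∀ a b : ({v}ᶜ : Set V),
      Function.extend (Sym2.map Subtype.val) c (fun _ => 0) s(a.1, b.1) = c s(a, b) := fun a b =>
    hinj.extend_apply c _ s(a, b)
  refine hG.2.1 ⟨Function.extend (Sym2.map Subtype.val) c fun _ => 0, ⟨?_, ?_⟩, ?_⟩
  · intro a b x y hab hxy hne
    obtain ⟨a, b, rfl, rfl⟩ := hlift hab
    obtain ⟨x, y, rfl, rfl⟩ := hlift hxy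
    rw [hext, hext]
    intro h0 h0'
    simpa [Subtype.ext_iff] using
      hc.1.1 a b x y hab hxy (fun h => hne (congrArg (Sym2.map Subtype.val) h)) h0 h0'
  · intro a b x y hab hxy hne
    obtain ⟨a, b, rfl, rfl⟩ := hlift hab
    obtain ⟨x, y, rfl, rfl⟩ := hlift hxy
    rw [hext, hext]
    intro h0 h0'
    simpa [Subtype.ext_iff] using
      hc.1.2 a b x y hab hxy (fun h => hne (congrArg (Sym2.map Subtype.val) h)) h0 h0'
  · intro a b hab
    obtain ⟨a, b, rfl, rfl⟩ := hlift hab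
    rw [hext, ← hnb, ← hnb]
    exact hc.2 a b hab

theorem MinCounter.two_le_ncard_neighborSet (hG : MinCounter V G) (v : V) :
    2 ≤ (G.neighborSet v).ncard := by
  classical
  by_contra! hlt
  obtain ⟨u, hu⟩ := hG.exists_adj v
  have hv : ∀ z, G.Adj v z → z = u := by
    intro z hz
    by_contra hne
    have : ({z, u} : Set V) ⊆ G.neighborSet v := by
      rintro _ (rfl | rfl) <;> assumption
    have := Set.ncard_le_ncard this
    rw [Set.ncard_pair hne] at this
    omega
  obtain ⟨c, hc⟩ := hG.exists_partialGood_edgesAvoiding (Y := {v}) rfl hu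
  have hnv : s(v, u) ∉ edgesAvoiding G {v} := fun h => h.2 v rfl (by simp)
  have h1 : (colorsNear G (edgesAvoiding G {v}) c v u).ncard ≤ 0 * 0 :=
    colorsNear_ncard_le (s := ∅) (by simp) (fun z hz hzu => absurd (hv z hz) hzu) (by simp)
  have h2 : (colorsNear G (edgesAvoiding G {v}) c u v).ncard ≤ 2 * 3 :=
    colorsNear_ncard_le_mul hu.symm (hG.1 u) fun z _ _ =>
      (colorsAt_ncard_le_edgesAt fun e he => Or.inl he).trans
        ((edgesAt_ncard_le edgesAvoiding_subset z).trans (hG.1 z))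
  obtain ⟨i, hi, hi1, hi2⟩ := exists_color (add_le_add h1 h2)
  have := hc.insert_edge edgesAvoiding_subset hnv hi hi1 hi2
  rw [show insert s(v, u) (edgesAvoiding G {v}) = G.edgeSet from ?_] at this
  · exact hG.not_partialGood _ this
  ext e
  constructor
  · rintro (rfl | he)
    · exact hu
    · exact he.1
  · intro he
    by_cases hve : v ∈ e
    · obtain ⟨z, rfl⟩ := hve
      exact Or.inl (by rw [hv z he])
    · exact Or.inr ⟨he, by rintro _ rfl; exact hve⟩

end Deletion

/-- Two edge colorings on the sides of a bridge can be aligned by a permutation that fixes `0`. -/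
theorem exists_perm_align {n m : Fin 8} {A B : Set (Fin 8)} (hn : n ≠ 0) (hm : m ≠ 0)
    (hA : A.ncard ≤ 2) (hB : B.ncard ≤ 2) (hB0 : 0 ∉ B) (hmB : m ∉ B) :
    ∃ σ : Equiv.Perm (Fin 8), σ 0 = 0 ∧ σ m = n ∧ ∀ i ∈ B, σ i ∉ A := by
  classical
  have h1 := le_freeColors_ncard (insert n A)
  have h2 := Set.ncard_insert_le n A
  obtain ⟨g, hg, hginj⟩ := (Set.toFinite B).exists_injOn_of_encard_le
    (t := freeColors (insert n A)) (by
      rw [← (Set.toFinite B).cast_ncard_eq, ← (Set.toFinite (freeColors _)).cast_ncard_eq]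
      exact_mod_cast (by omega : B.ncard ≤ (freeColors (insert n A)).ncard))
  have hg' : ∀ i ∈ B, g i ≠ 0 ∧ g i ≠ n ∧ g i ∉ A := fun i hi =>
    ⟨(hg hi).1, fun h => (hg hi).2 (Or.inl h), fun h => (hg hi).2 (Or.inr h)⟩
  obtain ⟨σ, hσ⟩ := Set.MapsTo.exists_equiv_extend_of_card_eq (t := (Finset.univ : Finset (Fin 8)))
    (by simp) (s := insert 0 (insert m B))
    (f := fun i => if i = 0 then 0 else if i = m then n else g i)
    (fun _ _ => by simp) (by
      intro i hi j hj hij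
      have hi' : i ≠ 0 → i ≠ m → i ∈ B := fun h h' => (hi.resolve_left h).resolve_left h'
      have hj' : j ≠ 0 → j ≠ m → j ∈ B := fun h h' => (hj.resolve_left h).resolve_left h'
      have := fun h h' => hg' i (hi' h h')
      have := fun h h' => hg' j (hj' h h')
      have := fun h h' k k' => hginj (hi' h h') (hj' k k')
      grind)
  refine ⟨σ.trans (Equiv.subtypeUnivEquiv (by simp)), ?_, ?_, fun i hi => ?_⟩
  · simpa using hσ 0 (by simp)
  · simpa [hm] using hσ m (by simp)
  · have hi0 : i ≠ 0 := by rintro rfl; exact hB0 hi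
    have him : i ≠ m := by rintro rfl; exact hmB hi
    have := hσ i (by simp [hi])
    simp only [hi0, him, if_false] at this
    simpa [this] using (hg' i hi).2.2

section Cut

variable {V : Type} {G : SimpleGraph V}

/-- The edges of `G` with an end in `X`. -/
def edgesMeeting (G : SimpleGraph V) (X : Set V) : Set (Sym2 V) :=
  {e | e ∈ G.edgeSet ∧ ∃ a ∈ X, a ∈ e}

theorem edgesMeeting_subset {X : Set V} : edgesMeeting G X ⊆ G.edgeSet := fun _ h => h.1

/-- The edges of `G` with exactly one end in `X`. -/
def edgeCut (G : SimpleGraph V) (X : Set V) : Set (Sym2 V) :=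
  {e | e ∈ G.edgeSet ∧ ∃ a ∈ X, ∃ b ∉ X, e = s(a, b)}

variable [Finite V]

/-- Colorings of the edges that meet `X` and of the edges that meet its complement combine. -/
theorem partialGood_combine (hG : Subcubic G) {X : Set V}
    (hcut : ∀ a ∈ X, ∀ b ∉ X, ∀ a' ∈ X, ∀ b' ∉ X, G.Adj a b → G.Adj a' b' → a = a' ∧ b = b')
    {c₁ c₂ : Sym2 V → Fin 8} {σ : Equiv.Perm (Fin 8)} (hσ : σ 0 = 0)
    (h₁ : PartialGood (fromEdgeSet (edgesMeeting G X)) (edgesMeeting G X) c₁)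
    (h₂ : PartialGood (fromEdgeSet (edgesMeeting G Xᶜ)) (edgesMeeting G Xᶜ) c₂)
    (hc : ∀ e ∈ edgesMeeting G X, ∀ f ∈ edgesMeeting G Xᶜ, f ∉ edgesMeeting G X →
      ∀ a ∈ e, ∀ b ∈ f, (a = b → c₁ e ≠ σ (c₂ f)) ∧ (G.Adj a b → c₁ e ≠ 0 → c₁ e ≠ σ (c₂ f))) :
    ∃ c, PartialGood G G.edgeSet c := by
  classical
  have hmem : ∀ e ∈ G.edgeSet, e ∉ edgesMeeting G X → ∀ a ∈ e, a ∉ X :=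
    fun e he hX a ha haX => hX ⟨he, a, haX, ha⟩
  have hmem' : ∀ e ∈ G.edgeSet, e ∉ edgesMeeting G X → e ∈ edgesMeeting G Xᶜ := by
    intro e he hX
    induction e with
    | h a b => exact ⟨he, a, hmem _ he hX a (by simp), by simp⟩
  have hcut' : ∀ e ∈ edgesMeeting G X, ∀ f ∈ edgesMeeting G X, ∀ a ∈ e, ∀ b ∈ f,
      a ∉ X → b ∉ X → a = b := by
    rintro e ⟨he, a', ha'X, ha'⟩ f ⟨hf, b', hb'X, hb'⟩ a ha b hb haX hbX
    have hea : e = s(a', a) := ((Sym2.mem_and_mem_iff (by rintro rfl; exact haX ha'X)).1 ⟨ha', ha⟩)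
    have hfb : f = s(b', b) := ((Sym2.mem_and_mem_iff (by rintro rfl; exact hbX hb'X)).1 ⟨hb', hb⟩)
    rw [hea] at he
    rw [hfb] at hf
    exact (hcut a' ha'X a haX b' hb'X b hbX he hf).2
  have hdeg : ∀ {E : Set (Sym2 V)}, E ⊆ G.edgeSet → ∀ a,
      ((fromEdgeSet E).neighborSet a).ncard = 3 → (G.neighborSet a).ncard = 3 := by
    intro E hE a ha
    refine le_antisymm (hG a) ?_
    rw [← ha]
    exact Set.ncard_le_ncard (neighborSet_fromEdgeSet_subset hE a)
  have hσ0 : ∀ i, σ i = 0 → i = 0 := fun i h => σ.injective (h.trans hσ.symm)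
  refine ⟨fun e => if e ∈ edgesMeeting G X then c₁ e else σ (c₂ e), ?_, ?_, ?_⟩
  · intro e he f hf hne h0 h0' a ha haf
    dsimp only at h0 h0'
    split_ifs at h0 h0' with heX hfX hfX
    · exact h₁.1 e heX f hfX hne h0 h0' a ha haf
    · exact (hc e heX f (hmem' f hf hfX) hfX a ha a haf).1 rfl (h0.trans h0'.symm)
    · exact (hc f hfX e (hmem' e he heX) heX a haf a ha).1 rfl (h0'.trans h0.symm)
    · exact h₂.1 e (hmem' e he heX) f (hmem' f hf hfX) hne (hσ0 _ h0) (hσ0 _ h0') a ha haf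
  · intro e he f hf hne heq h0 a ha b hb
    dsimp only at heq h0
    split_ifs at heq h0 with heX hfX hfX
    · have := h₁.2.1 e heX f hfX hne heq h0 a ha b hb
      refine ⟨this.1, fun hab => this.2 ⟨⟨hab, ?_⟩, this.1⟩⟩
      by_contra! hX
      exact this.1 (hcut' e heX f hfX a ha b hb (fun h => hX a h (by simp))
        (fun h => hX b h (by simp)))
    · have := hc e heX f (hmem' f hf hfX) hfX a ha b hb
      exact ⟨fun h => this.1 h heq, fun h => this.2 h h0 heq⟩
    · have := hc f hfX e (hmem' e he heX) heX b hb a ha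
      exact ⟨fun h => this.1 h.symm heq.symm, fun h => this.2 h.symm (heq ▸ h0) heq.symm⟩
    · have := h₂.2.1 e (hmem' e he heX) f (hmem' f hf hfX) hne (σ.injective heq)
        (fun h => h0 (by rw [h, hσ])) a ha b hb
      exact ⟨this.1, fun hab => this.2 ⟨⟨hab, a, hmem e he heX a ha, by simp⟩, this.1⟩⟩
  · intro e he h0 a ha
    dsimp only at h0
    split_ifs at h0 with heX
    · exact hdeg edgesMeeting_subset a (h₁.2.2 e heX h0 a ha)
    · exact hdeg edgesMeeting_subset a (h₂.2.2 e (hmem' e he heX) (hσ0 _ h0) a ha)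

theorem MinCounter.two_le_ncard_edgeCut (hG : MinCounter V G) {X : Set V} (hX : X.Nonempty)
    (hX' : Xᶜ.Nonempty) : 2 ≤ (edgeCut G X).ncard := by
  classical
  by_contra! hlt
  have hcut : ∀ a ∈ X, ∀ b ∉ X, ∀ a' ∈ X, ∀ b' ∉ X, G.Adj a b → G.Adj a' b' →
      a = a' ∧ b = b' := by
    intro a ha b hb a' ha' b' hb' hab hab'
    have h := (Set.ncard_le_one (Set.toFinite _)).1 (Nat.le_of_lt_succ hlt) s(a, b)
      ⟨hab, a, ha, b, hb, rfl⟩ s(a', b') ⟨hab', a', ha', b', hb', rfl⟩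
    rcases Sym2.eq_iff.1 h with h | ⟨rfl, rfl⟩
    · exact h
    · exact absurd ha hb'
  have hinner : ∀ Y : Set V, Y.Nonempty →
      (∀ a ∈ Y, ∀ b ∉ Y, ∀ a' ∈ Y, ∀ b' ∉ Y, G.Adj a b → G.Adj a' b' → a = a' ∧ b = b') →
      edgesMeeting G Yᶜ ⊂ G.edgeSet := by
    intro Y ⟨y, hy⟩ hY
    refine ⟨edgesMeeting_subset, fun h => ?_⟩
    obtain ⟨u, hu, w, hw, huw⟩ :=
      (Set.one_lt_ncard (Set.toFinite _)).1 (hG.two_le_ncard_neighborSet y)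
    have hout : ∀ z, G.Adj y z → z ∉ Y := by
      intro z hz hzY
      obtain ⟨-, a, ha, ha'⟩ := h (a := s(y, z)) hz
      rcases Sym2.mem_iff.1 ha' with rfl | rfl
      · exact ha hy
      · exact ha hzY
    exact huw (hY y hy u (hout u hu) y hy w (hout w hw) hu hw).2
  obtain ⟨c₁, h₁⟩ := hG.exists_partialGood (E := edgesMeeting G X) (by
    have := hinner Xᶜ hX' (fun a ha b hb a' ha' b' hb' h h' =>
      (hcut b (not_not.1 hb) a ha b' (not_not.1 hb') a' ha' h.symm h'.symm).symm)
    rwa [compl_compl] at this)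
  obtain ⟨c₂, h₂⟩ := hG.exists_partialGood (hinner X hX hcut)
  suffices ∃ c, PartialGood G G.edgeSet c from hG.not_partialGood _ this.choose_spec
  by_cases hbr : ∃ a ∈ X, ∃ b ∉ X, G.Adj a b
  swap
  · refine partialGood_combine hG.1 hcut (σ := 1) rfl h₁ h₂ ?_
    push Not at hbr
    rintro e ⟨he, a', ha'X, ha'⟩ f ⟨hf, -⟩ hfX a ha b hb
    have hbX : b ∉ X := fun h => hfX ⟨hf, b, h, hb⟩
    have haX : a ∈ X := by
      by_contra haX
      have hea : e = s(a', a) :=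
        ((Sym2.mem_and_mem_iff (by rintro rfl; exact haX ha'X)).1 ⟨ha', ha⟩)
      rw [hea] at he
      exact hbr a' ha'X a haX he
    exact ⟨fun h => absurd haX (h ▸ hbX), fun h => absurd h (hbr a haX b hbX)⟩
  obtain ⟨a₀, ha₀, b₀, hb₀, hab⟩ := hbr
  have hβ₁ : s(a₀, b₀) ∈ edgesMeeting G X := ⟨hab, a₀, ha₀, by simp⟩
  have hβ₂ : s(a₀, b₀) ∈ edgesMeeting G Xᶜ := ⟨hab, b₀, hb₀, by simp⟩
  have hn : c₁ s(a₀, b₀) ≠ 0 := by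
    intro h
    have h3 := h₁.2.2 _ hβ₁ h b₀ (by simp)
    have hsub : (fromEdgeSet (edgesMeeting G X)).neighborSet b₀ ⊆ {a₀} := by
      rintro z ⟨⟨hz, w, hw, hw'⟩, -⟩
      rcases Sym2.mem_iff.1 hw' with rfl | rfl
      · exact absurd hw hb₀
      · exact (hcut w hw b₀ hb₀ a₀ ha₀ b₀ hb₀ hz.symm hab).1
    have := Set.ncard_le_ncard hsub
    rw [Set.ncard_singleton] at this
    omega
  have hm : c₂ s(a₀, b₀) ≠ 0 := by
    intro h
    have h3 := h₂.2.2 _ hβ₂ h a₀ (by simp)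
    have hsub : (fromEdgeSet (edgesMeeting G Xᶜ)).neighborSet a₀ ⊆ {b₀} := by
      rintro z ⟨⟨hz, w, hw, hw'⟩, -⟩
      rcases Sym2.mem_iff.1 hw' with rfl | rfl
      · exact absurd ha₀ hw
      · exact (hcut a₀ ha₀ w hw a₀ ha₀ b₀ hb₀ hz hab).2
    have := Set.ncard_le_ncard hsub
    rw [Set.ncard_singleton] at this
    omega
  have hcard : ∀ (E : Set (Sym2 V)) (c : Sym2 V → Fin 8) (z : V), E ⊆ G.edgeSet →
      z ∈ s(a₀, b₀) → (colorsAt (E \ {s(a₀, b₀)}) c z).ncard ≤ 2 := by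
    intro E c z hE hz
    have h1 := edgesAt_ncard_lt (E := E \ {s(a₀, b₀)}) (fun e he => hE he.1) hab hz (by simp)
    have h2 := colorsAt_ncard_le_edgesAt (c := c) (z := z) fun e (he : e ∈ E \ {s(a₀, b₀)}) =>
      Or.inl he
    have := hG.1 z
    omega
  have hshare : ∀ f ∈ edgesMeeting G Xᶜ, f ∉ edgesMeeting G X → ∀ b ∈ f,
      (b₀ = b ∨ G.Adj b₀ b) → c₂ f ≠ c₂ s(a₀, b₀) := by
    intro f hf hfX b hb hbb hcf
    have hbX : b ∉ X := fun h => hfX ⟨hf.1, b, h, hb⟩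
    have := h₂.2.1 _ hβ₂ f hf (by rintro rfl; exact hfX hβ₁) hcf.symm hm b₀ (by simp) b hb
    exact hbb.elim this.1 fun h => this.2 ⟨⟨h, b, hbX, by simp⟩, h.ne⟩
  obtain ⟨σ, hσ0, hσm, hσ⟩ := exists_perm_align hn hm
    (hcard _ c₁ a₀ (edgesMeeting_subset (X := X)) (by simp))
    (hcard _ c₂ b₀ (edgesMeeting_subset (X := Xᶜ)) (by simp)) (by simp [colorsAt]) (by
      rintro ⟨-, f, ⟨hf, hne⟩, hb, hcf⟩
      exact (h₂.2.1 _ hβ₂ f hf (Ne.symm hne) hcf.symm hm b₀ (by simp) b₀ hb).1 rfl)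
  refine partialGood_combine hG.1 hcut hσ0 h₁ h₂ ?_
  intro e he f hf hfX a ha b hb
  have hbX : b ∉ X := fun h => hfX ⟨hf.1, b, h, hb⟩
  have hβ : a ∉ X → e = s(a₀, b₀) ∧ a = b₀ := by
    intro haX
    obtain ⟨hee, a', ha'X, ha'⟩ := he
    have hea : e = s(a', a) := ((Sym2.mem_and_mem_iff (by rintro rfl; exact haX ha'X)).1 ⟨ha', ha⟩)
    rw [hea] at hee
    obtain ⟨rfl, rfl⟩ := hcut a' ha'X a haX a₀ ha₀ b₀ hb₀ hee hab
    exact ⟨hea, rfl⟩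
  have hne : ∀ b ∈ f, (b₀ = b ∨ G.Adj b₀ b) → c₁ s(a₀, b₀) ≠ σ (c₂ f) := by
    intro b hb h heq
    exact hshare f hf hfX b hb h (σ.injective (heq.symm.trans hσm.symm))
  constructor
  · rintro rfl
    obtain ⟨rfl, rfl⟩ := hβ hbX
    exact hne _ hb (Or.inl rfl)
  · intro hadj h0 heq
    by_cases haX : a ∈ X
    · obtain ⟨rfl, rfl⟩ := hcut a haX b hbX a₀ ha₀ b₀ hb₀ hadj hab
      by_cases heβ : e = s(a, b)
      · rw [heβ] at heq
        exact hne _ hb (Or.inl rfl) heq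
      · refine hσ (c₂ f) ⟨?_, f, ⟨hf, by rintro rfl; exact hfX hβ₁⟩, hb, rfl⟩ ?_
        · intro h
          rw [h, hσ0] at heq
          exact h0 heq
        · exact ⟨heq ▸ h0, e, ⟨he, heβ⟩, ha, heq⟩
    · obtain ⟨rfl, rfl⟩ := hβ haX
      exact hne b hb (Or.inr hadj) heq

end Cut

theorem mem_freeColors {s : Set (Fin 8)} {i : Fin 8} : i ∈ freeColors s ↔ i ≠ 0 ∧ i ∉ s := Iff.rfl

theorem exists_mem_mem_ne {α : Type*} [Finite α] {s t : Set α} (hs : s.Nonempty) (ht : t.Nonempty)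
    (h : 3 ≤ s.ncard + t.ncard) : ∃ a ∈ s, ∃ b ∈ t, a ≠ b := by
  by_contra! hst
  obtain ⟨a, ha⟩ := hs
  obtain ⟨b, hb⟩ := ht
  have h1 : s ⊆ {b} := fun i hi => hst i hi b hb
  have h2 : t ⊆ {a} := fun i hi => (hst a ha i hi).symm
  have h3 := Set.ncard_le_ncard h1
  have h4 := Set.ncard_le_ncard h2
  simp only [Set.ncard_singleton] at h3 h4
  omega

theorem exists_pair_ne_diff {α : Type*} [Finite α] {s t u : Set α} (hs : u.ncard < s.ncard)
    (ht : u.ncard < t.ncard) (h : 2 * u.ncard + 3 ≤ s.ncard + t.ncard) :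
    ∃ a ∈ s \ u, ∃ b ∈ t \ u, a ≠ b := by
  have h1 := Set.ncard_le_ncard_sdiff_add_ncard s u
  have h2 := Set.ncard_le_ncard_sdiff_add_ncard t u
  exact exists_mem_mem_ne (Set.nonempty_of_ncard_ne_zero (by omega))
    (Set.nonempty_of_ncard_ne_zero (by omega)) (by omega)

theorem exists_selection_ne {α : Type*} [Finite α] {P Q A B : Set α} (hP : 2 ≤ P.ncard)
    (hQ : 2 ≤ Q.ncard) (hA : 3 ≤ A.ncard) (hB : 3 ≤ B.ncard) (hAB : 7 ≤ A.ncard + B.ncard) :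
    ∃ p ∈ P, ∃ q ∈ Q, p ≠ q ∧ ∃ a ∈ A \ {p, q}, ∃ b ∈ B \ {p, q}, a ≠ b := by
  obtain ⟨p, hp, q, hq, hpq⟩ := exists_mem_mem_ne (s := P) (t := Q)
    (Set.nonempty_of_ncard_ne_zero (by omega)) (Set.nonempty_of_ncard_ne_zero (by omega)) (by omega)
  refine ⟨p, hp, q, hq, hpq, exists_pair_ne_diff ?_ ?_ ?_⟩ <;> rw [Set.ncard_pair hpq] <;> omega

theorem exists_selection {α : Type*} [Finite α] {P Q A B : Set α}
    (hPA : 1 ≤ P.ncard ∧ 4 ≤ A.ncard ∨ 2 ≤ P.ncard ∧ 3 ≤ A.ncard)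
    (hQB : 1 ≤ Q.ncard ∧ 4 ≤ B.ncard ∨ 2 ≤ Q.ncard ∧ 3 ≤ B.ncard) :
    ∃ p ∈ P, ∃ q ∈ Q, ∃ a ∈ A \ {p, q}, ∃ b ∈ B \ {p, q}, a ≠ b := by
  classical
  have hpair : ∀ p q : α, ({p, q} : Set α).ncard ≤ 2 := fun p q => by
    have := Set.ncard_insert_le p {q}
    rwa [Set.ncard_singleton] at this
  obtain ⟨p, hp⟩ := Set.nonempty_of_ncard_ne_zero (s := P) (by omega)
  obtain ⟨q, hq⟩ := Set.nonempty_of_ncard_ne_zero (s := Q) (by omega)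
  by_cases h7 : 7 ≤ A.ncard + B.ncard
  · have := hpair p q
    exact ⟨p, hp, q, hq, exists_pair_ne_diff (by omega) (by omega) (by omega)⟩
  by_cases hPQ : (P ∩ Q).Nonempty
  · obtain ⟨r, hrP, hrQ⟩ := hPQ
    refine ⟨r, hrP, r, hrQ, exists_pair_ne_diff ?_ ?_ ?_⟩ <;>
      rw [Set.pair_eq_singleton, Set.ncard_singleton] <;> omega
  have hout : ∀ p q r, r ∉ A → ({p, q} : Set α) = {r, p} ∨ ({p, q} : Set α) = {r, q} →
      ∃ a ∈ A \ {p, q}, ∃ b ∈ B \ {p, q}, a ≠ b := by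
    intro p q r hr hpq
    have h1 : 2 ≤ (A \ {p, q}).ncard := by
      have : ∃ s, ({p, q} : Set α) = {r, s} := hpq.elim (fun h => ⟨_, h⟩) fun h => ⟨_, h⟩
      obtain ⟨s, hs⟩ := this
      have h2 : A \ {p, q} = A \ {s} := by
        rw [hs]
        ext i
        simp only [Set.mem_sdiff, Set.mem_insert_iff, Set.mem_singleton_iff]
        grind
      rw [h2]
      have := Set.ncard_le_ncard_sdiff_add_ncard A {s}
      rw [Set.ncard_singleton] at this
      omega
    have h2 := Set.ncard_le_ncard_sdiff_add_ncard B {p, q}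
    have := hpair p q
    exact exists_mem_mem_ne (Set.nonempty_of_ncard_ne_zero (by omega))
      (Set.nonempty_of_ncard_ne_zero (by omega)) (by omega)
  by_cases hPA' : P ⊆ A
  · by_cases hQA : Q ⊆ A
    · have h1 := Set.ncard_le_ncard (Set.union_subset hPA' hQA)
      rw [Set.ncard_union_eq (Set.disjoint_iff_inter_eq_empty.2 (Set.not_nonempty_iff_eq_empty.1
        hPQ))] at h1
      omega
    · obtain ⟨r, hr, hrA⟩ := Set.not_subset.1 hQA
      exact ⟨p, hp, r, hr, hout p r r hrA (Or.inl (Set.pair_comm _ _))⟩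
  · obtain ⟨r, hr, hrA⟩ := Set.not_subset.1 hPA'
    exact ⟨r, hr, q, hq, hout r q r hrA (Or.inr rfl)⟩

theorem eq_pair_of_ncard_eq_two {α : Type*} {s : Set α} {a : α} (ha : a ∈ s) (hs : s.ncard = 2) :
    ∃ b, b ≠ a ∧ s = {a, b} := by
  obtain ⟨c, d, hcd, rfl⟩ := Set.ncard_eq_two.1 hs
  rcases ha with rfl | rfl
  · exact ⟨d, hcd.symm, rfl⟩
  · exact ⟨c, hcd, Set.pair_comm _ _⟩

theorem eq_triple_of_ncard_eq_three {α : Type*} {s : Set α} {a b : α} (ha : a ∈ s) (hb : b ∈ s)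
    (hab : a ≠ b) (hs : s.ncard = 3) : ∃ c, c ≠ a ∧ c ≠ b ∧ s = {a, b, c} := by
  obtain ⟨x, y, z, hxy, hxz, hyz, rfl⟩ := Set.ncard_eq_three.1 hs
  simp only [Set.mem_insert_iff, Set.mem_singleton_iff] at ha hb
  have key : ∀ c, c ∈ ({x, y, z} : Set α) → c ≠ a → c ≠ b → ({x, y, z} : Set α) = {a, b, c} := by
    intro c hc hca hcb
    ext i
    simp only [Set.mem_insert_iff, Set.mem_singleton_iff] at hc ⊢
    grind
  have : x ≠ a ∧ x ≠ b ∨ y ≠ a ∧ y ≠ b ∨ z ≠ a ∧ z ≠ b := by grind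
  obtain ⟨c, hc, hca, hcb⟩ : ∃ c ∈ ({x, y, z} : Set α), c ≠ a ∧ c ≠ b := by
    rcases this with h | h | h
    · exact ⟨x, by simp, h⟩
    · exact ⟨y, by simp, h⟩
    · exact ⟨z, by simp, h⟩
  exact ⟨c, hca, hcb, key c hc hca hcb⟩

section Maximal

variable {V : Type} {G : SimpleGraph V}

theorem mem_colorsNear_iff {E : Set (Sym2 V)} {c : Sym2 V → Fin 8} {x y : V} {i : Fin 8} :
    i ∈ colorsNear G E c x y ↔ ∃ z, G.Adj x z ∧ z ≠ y ∧ i ∈ colorsAt E c z := by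
  simp [colorsNear, and_assoc]

theorem mem_colorsAt_insert [DecidableEq V] {E : Set (Sym2 V)} {c : Sym2 V → Fin 8} {e : Sym2 V}
    {i j : Fin 8} {z : V} (h : j ∈ colorsAt (insert e E) (Function.update c e i) z) :
    j = i ∧ z ∈ e ∨ j ∈ colorsAt E c z := by
  obtain ⟨hj, f, hf, hz, rfl⟩ := h
  by_cases hfe : f = e
  · subst hfe
    exact Or.inl ⟨by simp, hz⟩
  · refine Or.inr ⟨hj, f, hf.resolve_left hfe, hz, ?_⟩
    rw [Function.update_of_ne hfe]

/-- Some edge of `E` at `z` has color `0`. -/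
def Covered (E : Set (Sym2 V)) (c : Sym2 V → Fin 8) (z : V) : Prop :=
  ∃ f ∈ E, c f = 0 ∧ z ∈ f

variable [Finite V]

theorem Covered.colorsAt_ncard_lt {E : Set (Sym2 V)} {c : Sym2 V → Fin 8} {z : V}
    (h : Covered E c z) : (colorsAt E c z).ncard < (edgesAt E z).ncard := by
  obtain ⟨f, hf, h0, hz⟩ := h
  exact colorsAt_ncard_le.trans_lt (Set.ncard_lt_ncard
    ⟨fun e he => ⟨he.1, he.2.1⟩, fun hsub => (hsub ⟨hf, hz⟩).2.2 h0⟩)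

theorem colorsAt_ncard_le_of_mem {E : Set (Sym2 V)} {c : Sym2 V → Fin 8} (z : V) :
    (colorsAt E c z).ncard ≤ (edgesAt E z).ncard :=
  colorsAt_ncard_le_edgesAt fun _ he => Or.inl he

/-- Among the partial good colorings of `E`, one with the most edges of color `0` leaves no edge
that can be recolored `0`. -/
theorem exists_maximal_partialGood {E : Set (Sym2 V)} (h : ∃ c, PartialGood G E c) :
    ∃ c, PartialGood G E c ∧ ∀ a b, s(a, b) ∈ E → (G.neighborSet a).ncard = 3 →
      (G.neighborSet b).ncard = 3 → Covered E c a ∨ Covered E c b := by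
  classical
  obtain ⟨c, hc, hmax⟩ := Set.exists_max_image {c | PartialGood G E c}
    (fun c => {e | e ∈ E ∧ c e = 0}.ncard) (Set.toFinite _) h
  refine ⟨c, hc, fun a b hab ha hb => ?_⟩
  by_contra! hcov
  have hcov' : ∀ f ∈ E, c f = 0 → ∀ z ∈ s(a, b), z ∉ f := by
    intro f hf h0 z hz hzf
    rcases Sym2.mem_iff.1 hz with rfl | rfl
    · exact hcov.1 ⟨f, hf, h0, hzf⟩
    · exact hcov.2 ⟨f, hf, h0, hzf⟩
  have hup : ∀ f, Function.update c s(a, b) 0 f = 0 ↔ f = s(a, b) ∨ c f = 0 := by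
    intro f
    by_cases hf : f = s(a, b)
    · simp [hf]
    · simp [hf]
  have hup' : ∀ f, Function.update c s(a, b) 0 f ≠ 0 → Function.update c s(a, b) 0 f = c f := by
    intro f hf
    refine Function.update_of_ne (fun h => hf ((hup f).2 (Or.inl h))) _ _
  have hgood : PartialGood G E (Function.update c s(a, b) 0) := by
    refine ⟨fun e he f hf hne h0 h0' z hz hzf => ?_, fun e he f hf hne heq h0 => ?_,
      fun e he h0 => ?_⟩
    · rw [hup] at h0 h0'
      rcases h0 with rfl | h0 <;> rcases h0' with rfl | h0'
      · exact hne rfl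
      · exact hcov' f hf h0' z hz hzf
      · exact hcov' e he h0 z hzf hz
      · exact hc.1 e he f hf hne h0 h0' z hz hzf
    · have h0' := heq ▸ h0
      rw [hup' e h0] at heq h0
      rw [hup' f h0'] at heq
      exact hc.2.1 e he f hf hne heq h0
    · rw [hup] at h0
      rcases h0 with rfl | h0
      · intro z hz
        rcases Sym2.mem_iff.1 hz with rfl | rfl <;> assumption
      · exact hc.2.2 e he h0
  refine (hmax _ hgood).not_gt (Set.ncard_lt_ncard ⟨fun e he => ⟨he.1, (hup e).2 (Or.inr he.2)⟩,
    fun hsub => ?_⟩)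
  exact hcov.1 ⟨s(a, b), hab, (hsub ⟨hab, (hup _).2 (Or.inl rfl)⟩).2, by simp⟩

end Maximal

section TwoVertices

variable {V : Type} {G : SimpleGraph V}

theorem colorsAt_edgesAvoiding_eq_empty {Y : Set V} {c : Sym2 V → Fin 8} {y : V} (hy : y ∈ Y) :
    colorsAt (edgesAvoiding G Y) c y = ∅ := by
  ext i
  simp only [Set.mem_empty_iff_false, iff_false]
  rintro ⟨-, e, he, hye, -⟩
  exact he.2 y hy hye

theorem mk_mem_edgesAvoiding {Y : Set V} {a b : V} (hab : G.Adj a b) (ha : a ∉ Y) (hb : b ∉ Y) :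
    s(a, b) ∈ edgesAvoiding G Y := by
  refine ⟨hab, fun y hy h => ?_⟩
  rcases Sym2.mem_iff.1 h with rfl | rfl <;> contradiction

/-- A partial good coloring of the edges avoiding `y₁` and `y₂` extends to the four edges at these
vertices when suitable colors are available. -/
theorem PartialGood.extend_four {c : Sym2 V → Fin 8} {x y₁ y₂ w₁ w₂ g : V}
    (hc : PartialGood G (edgesAvoiding G {y₁, y₂}) c)
    (hy : y₁ ≠ y₂) (hx : G.neighborSet x = {y₁, y₂, g})
    (hy₁ : G.neighborSet y₁ = {x, w₁}) (hy₂ : G.neighborSet y₂ = {x, w₂}) (hw₁ : w₁ ≠ x)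
    (hw₂ : w₂ ≠ x) (hw₁₂ : w₁ ≠ y₂) (hw₂₁ : w₂ ≠ y₁) {p q i j : Fin 8} (hp0 : p ≠ 0)
    (hq0 : q ≠ 0) (hi0 : i ≠ 0) (hj0 : j ≠ 0)
    (hp : p ∉ colorsNear G (edgesAvoiding G {y₁, y₂}) c w₁ y₁)
    (hpx : p ∉ colorsAt (edgesAvoiding G {y₁, y₂}) c x)
    (hq : q ∉ colorsNear G (edgesAvoiding G {y₁, y₂}) c w₂ y₂)
    (hqx : q ∉ colorsAt (edgesAvoiding G {y₁, y₂}) c x)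
    (hpq : w₁ = w₂ ∨ G.Adj w₁ w₂ → p ≠ q)
    (hig : i ∉ colorsAt (edgesAvoiding G {y₁, y₂}) c g)
    (hiw : i ∉ colorsAt (edgesAvoiding G {y₁, y₂}) c w₁) (hip : i ≠ p) (hiq : i ≠ q)
    (hjg : j ∉ colorsAt (edgesAvoiding G {y₁, y₂}) c g)
    (hjw : j ∉ colorsAt (edgesAvoiding G {y₁, y₂}) c w₂) (hjp : j ≠ p) (hjq : j ≠ q)
    (hij : i ≠ j) : ∃ c, PartialGood G G.edgeSet c := by
  classical
  have ax : ∀ z, G.Adj x z ↔ z = y₁ ∨ z = y₂ ∨ z = g := fun z => by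
    rw [← mem_neighborSet, hx]; simp
  have ay₁ : ∀ z, G.Adj y₁ z ↔ z = x ∨ z = w₁ := fun z => by rw [← mem_neighborSet, hy₁]; simp
  have ay₂ : ∀ z, G.Adj y₂ z ↔ z = x ∨ z = w₂ := fun z => by rw [← mem_neighborSet, hy₂]; simp
  have hxy₁ : x ≠ y₁ := ((ax y₁).2 (by simp)).ne
  have hxy₂ : x ≠ y₂ := ((ax y₂).2 (by simp)).ne
  have hw₁y : w₁ ≠ y₁ := ((ay₁ w₁).2 (by simp)).ne.symm
  have hw₂y : w₂ ≠ y₂ := ((ay₂ w₂).2 (by simp)).ne.symm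
  have awy₁ : ∀ z, G.Adj z y₁ ↔ z = x ∨ z = w₁ := fun z => by rw [G.adj_comm, ay₁]
  have awy₂ : ∀ z, G.Adj z y₂ ↔ z = x ∨ z = w₂ := fun z => by rw [G.adj_comm, ay₂]
  set E := edgesAvoiding G {y₁, y₂} with hE
  have hEy₁ : ∀ z, s(z, y₁) ∉ E := fun z h => h.2 y₁ (by simp) (by simp)
  have hEy₂ : ∀ z, s(z, y₂) ∉ E := fun z h => h.2 y₂ (by simp) (by simp)
  have hcy₁ : colorsAt E c y₁ = ∅ := colorsAt_edgesAvoiding_eq_empty (by simp)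
  have hcy₂ : colorsAt E c y₂ = ∅ := colorsAt_edgesAvoiding_eq_empty (by simp)
  have hins : ∀ {F : Set (Sym2 V)} {a b : V}, F ⊆ G.edgeSet → G.Adj a b →
      insert s(a, b) F ⊆ G.edgeSet := fun hF hab => Set.insert_subset hab hF
  have hs₀ : E ⊆ G.edgeSet := edgesAvoiding_subset
  have h₁ := hc.insert_edge (x := w₁) (y := y₁) (i := p) hs₀ (hEy₁ _) hp0 hp (by
    rw [mem_colorsNear_iff]
    rintro ⟨z, hz, hzw, hzc⟩
    rcases (ay₁ z).1 hz with rfl | rfl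
    · exact hpx hzc
    · exact hzw rfl)
  have hs₁ := hins hs₀ ((awy₁ w₁).2 (Or.inr rfl))
  set E₁ := insert s(w₁, y₁) E with hE₁
  set c₁ := Function.update c s(w₁, y₁) p with hc₁
  have hA₁ : ∀ {k z}, k ∈ colorsAt E₁ c₁ z → k = p ∧ (z = w₁ ∨ z = y₁) ∨ k ∈ colorsAt E c z := by
    intro k z h
    simpa using mem_colorsAt_insert h
  have h₂ := h₁.insert_edge (x := w₂) (y := y₂) (i := q) hs₁ (by
      rintro (h | h)
      · rcases Sym2.eq_iff.1 h with ⟨-, h⟩ | ⟨h, -⟩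
        · exact hy h.symm
        · exact hw₂₁ h
      · exact hEy₂ _ h) hq0 (by
    rw [mem_colorsNear_iff] at hq ⊢
    rintro ⟨z, hz, hzw, hzc⟩
    rcases hA₁ hzc with ⟨rfl, rfl | rfl⟩ | hzc
    · exact hpq (Or.inr hz.symm) rfl
    · rcases (awy₁ w₂).1 hz with h | h
      · exact hw₂ h
      · exact hpq (Or.inl h.symm) rfl
    · exact hq ⟨z, hz, hzw, hzc⟩) (by
    rw [mem_colorsNear_iff]
    rintro ⟨z, hz, hzw, hzc⟩
    rcases (ay₂ z).1 hz with rfl | rfl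
    · rcases hA₁ hzc with ⟨-, rfl | rfl⟩ | hzc
      · exact hw₁ rfl
      · exact hxy₁ rfl
      · exact hqx hzc
    · exact hzw rfl)
  have hs₂ := hins hs₁ ((awy₂ w₂).2 (Or.inr rfl))
  set E₂ := insert s(w₂, y₂) E₁ with hE₂
  set c₂ := Function.update c₁ s(w₂, y₂) q with hc₂
  have hA₂ : ∀ {k z}, k ∈ colorsAt E₂ c₂ z → k = q ∨ k = p ∨ k ∈ colorsAt E c z := by
    intro k z h
    rcases mem_colorsAt_insert h with h | h
    · exact Or.inl h.1
    · rcases hA₁ h with h | h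
      · exact Or.inr (Or.inl h.1)
      · exact Or.inr (Or.inr h)
  have h₃ := h₂.insert_edge (x := x) (y := y₁) (i := i) hs₂ (by
      rintro (h | h | h)
      · rcases Sym2.eq_iff.1 h with ⟨h, -⟩ | ⟨h, -⟩
        · exact hw₂ h.symm
        · exact hxy₂ h
      · rcases Sym2.eq_iff.1 h with ⟨h, -⟩ | ⟨h, -⟩
        · exact hw₁ h.symm
        · exact hxy₁ h
      · exact hEy₁ _ h) hi0 (by
    rw [mem_colorsNear_iff]
    rintro ⟨z, hz, hzw, hzc⟩
    rcases hA₂ hzc with h | h | h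
    · exact hiq h
    · exact hip h
    · rcases (ax z).1 hz with rfl | rfl | rfl
      · exact hzw rfl
      · rw [hcy₂] at h; exact h
      · exact hig h) (by
    rw [mem_colorsNear_iff]
    rintro ⟨z, hz, hzw, hzc⟩
    rcases hA₂ hzc with h | h | h
    · exact hiq h
    · exact hip h
    · rcases (ay₁ z).1 hz with rfl | rfl
      · exact hzw rfl
      · exact hiw h)
  have hs₃ := hins hs₂ ((awy₁ x).2 (Or.inl rfl))
  set E₃ := insert s(x, y₁) E₂ with hE₃
  set c₃ := Function.update c₂ s(x, y₁) i with hc₃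
  have hA₃ : ∀ {k z}, k ∈ colorsAt E₃ c₃ z → k = i ∨ k = q ∨ k = p ∨ k ∈ colorsAt E c z := by
    intro k z h
    rcases mem_colorsAt_insert h with h | h
    · exact Or.inl h.1
    · exact Or.inr (hA₂ h)
  have h₄ := h₃.insert_edge (x := x) (y := y₂) (i := j) hs₃ (by
      rintro (h | h | h | h)
      · rcases Sym2.eq_iff.1 h with ⟨-, h⟩ | ⟨h, -⟩
        · exact hy h.symm
        · exact hxy₁ h
      · rcases Sym2.eq_iff.1 h with ⟨h, -⟩ | ⟨h, -⟩
        · exact hw₂ h.symm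
        · exact hxy₂ h
      · rcases Sym2.eq_iff.1 h with ⟨h, -⟩ | ⟨h, -⟩
        · exact hw₁ h.symm
        · exact hxy₁ h
      · exact hEy₂ _ h) hj0 (by
    rw [mem_colorsNear_iff]
    rintro ⟨z, hz, hzw, hzc⟩
    rcases hA₃ hzc with h | h | h | h
    · exact hij h.symm
    · exact hjq h
    · exact hjp h
    · rcases (ax z).1 hz with rfl | rfl | rfl
      · rw [hcy₁] at h; exact h
      · exact hzw rfl
      · exact hjg h) (by
    rw [mem_colorsNear_iff]
    rintro ⟨z, hz, hzw, hzc⟩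
    rcases hA₃ hzc with h | h | h | h
    · exact hij h.symm
    · exact hjq h
    · exact hjp h
    · rcases (ay₂ z).1 hz with rfl | rfl
      · exact hzw rfl
      · exact hjw h)
  refine ⟨Function.update c₃ s(x, y₂) j, ?_⟩
  convert h₄ using 1
  ext e
  constructor
  · intro he
    by_cases hy₁e : y₁ ∈ e
    · obtain ⟨z, rfl⟩ := hy₁e
      rcases (ay₁ z).1 he with rfl | rfl
      · exact Or.inr (Or.inl Sym2.eq_swap)
      · exact Or.inr (Or.inr (Or.inr (Or.inl Sym2.eq_swap)))
    by_cases hy₂e : y₂ ∈ e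
    · obtain ⟨z, rfl⟩ := hy₂e
      rcases (ay₂ z).1 he with rfl | rfl
      · exact Or.inl Sym2.eq_swap
      · exact Or.inr (Or.inr (Or.inl Sym2.eq_swap))
    refine Or.inr (Or.inr (Or.inr (Or.inr ⟨he, ?_⟩)))
    rintro _ (rfl | rfl) <;> assumption
  · exact fun he => hins hs₃ ((awy₂ x).2 (Or.inl rfl)) he

variable [Finite V]

/-- The two neighbors of a vertex other than `y`, one of which is `z`. -/
theorem exists_colorsNear_ncard_le_add {E : Set (Sym2 V)} {c : Sym2 V → Fin 8} {w y z : V}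
    (hw : (G.neighborSet w).ncard ≤ 3) (hwy : G.Adj w y) (hwz : G.Adj w z) (hzy : z ≠ y) :
    ∃ t, (∀ u, G.Adj w u → u ≠ y → u = z ∨ u = t) ∧
      (colorsNear G E c w y).ncard ≤ (colorsAt E c z).ncard + (colorsAt E c t).ncard := by
  obtain ⟨t, ht⟩ : ∃ t, ∀ u, G.Adj w u → u ≠ y → u = z ∨ u = t := by
    by_cases ht : ∃ t, G.Adj w t ∧ t ≠ y ∧ t ≠ z
    · obtain ⟨t, hwt, hty, htz⟩ := ht
      refine ⟨t, fun u hu huy => ?_⟩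
      by_contra! h
      have hsub : ({u, t, z, y} : Set V) ⊆ G.neighborSet w := by
        rintro _ (rfl | rfl | rfl | rfl) <;> assumption
      have := Set.ncard_le_ncard hsub
      rw [Set.ncard_insert_of_notMem (by simp [h, huy]), Set.ncard_insert_of_notMem
        (by simp [hty, htz]), Set.ncard_pair hzy] at this
      omega
    · push Not at ht
      exact ⟨z, fun u hu huy => Or.inl (ht u hu huy)⟩
  refine ⟨t, ht, (Set.ncard_le_ncard ?_).trans (Set.ncard_union_le _ _)⟩
  intro i hi
  obtain ⟨u, hu, huy, hi⟩ := mem_colorsNear_iff.1 hi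
  rcases ht u hu huy with rfl | rfl
  · exact Or.inl hi
  · exact Or.inr hi

theorem MinCounter.colorsAt_ncard_le_three (hG : MinCounter V G) {E : Set (Sym2 V)}
    (hE : E ⊆ G.edgeSet) (c : Sym2 V → Fin 8) (z : V) : (colorsAt E c z).ncard ≤ 3 :=
  (colorsAt_ncard_le_of_mem z).trans ((edgesAt_ncard_le hE z).trans (hG.1 z))

theorem MinCounter.colorsAt_ncard_le_two (hG : MinCounter V G) {E : Set (Sym2 V)}
    (hE : E ⊆ G.edgeSet) {c : Sym2 V → Fin 8} {z : V}
    (hz : (G.neighborSet z).ncard = 3 → Covered E c z) : (colorsAt E c z).ncard ≤ 2 := by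
  have h1 := edgesAt_ncard_le hE z
  have h2 := hG.1 z
  by_cases h3 : (G.neighborSet z).ncard = 3
  · have := (hz h3).colorsAt_ncard_lt
    omega
  · have := colorsAt_ncard_le_of_mem (E := E) (c := c) z
    omega

/-- No edge with two ends of degree 3 has both ends missed by the color `0`. -/
def ZeroMaximal (G : SimpleGraph V) (E : Set (Sym2 V)) (c : Sym2 V → Fin 8) : Prop :=
  ∀ a b, s(a, b) ∈ E → (G.neighborSet a).ncard = 3 → (G.neighborSet b).ncard = 3 →
    Covered E c a ∨ Covered E c b

theorem MinCounter.colorsAt_ncard_le_two_of_not_covered (hG : MinCounter V G) {Y : Set V}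
    {c : Sym2 V → Fin 8} (hmax : ZeroMaximal G (edgesAvoiding G Y) c) {w : V} (hw : w ∉ Y)
    (hw3 : (G.neighborSet w).ncard = 3) (hcov : ¬Covered (edgesAvoiding G Y) c w) {z : V}
    (hz : G.Adj w z) : (colorsAt (edgesAvoiding G Y) c z).ncard ≤ 2 := by
  by_cases hzY : z ∈ Y
  · simp [colorsAt_edgesAvoiding_eq_empty hzY]
  · exact hG.colorsAt_ncard_le_two edgesAvoiding_subset fun h3 =>
      (hmax w z (mk_mem_edgesAvoiding hz hw hzY) hw3 h3).resolve_left hcov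

theorem MinCounter.colorsNear_bound (hG : MinCounter V G) {Y : Set V} {c : Sym2 V → Fin 8}
    (hmax : ZeroMaximal G (edgesAvoiding G Y) c) {w y : V} (hw : w ∉ Y) (hy : y ∈ Y)
    (hwy : G.Adj w y) :
    (colorsNear G (edgesAvoiding G Y) c w y).ncard ≤ 5 ∧
        (colorsAt (edgesAvoiding G Y) c w).ncard ≤ 1 ∨
      (colorsNear G (edgesAvoiding G Y) c w y).ncard ≤ 4 ∧
        (colorsAt (edgesAvoiding G Y) c w).ncard ≤ 2 := by
  have hlt := edgesAt_ncard_lt (edgesAvoiding_subset (Y := Y)) (e := s(w, y)) hwy (z := w) (by simp)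
    fun h => h.2 y hy (by simp)
  have hat := colorsAt_ncard_le_of_mem (E := edgesAvoiding G Y) (c := c) w
  have h3 := hG.1 w
  by_cases hw3 : (G.neighborSet w).ncard = 3
  swap
  · have := colorsNear_ncard_le_mul (E := edgesAvoiding G Y) (c := c) hwy (n := 1) (by omega)
      fun z _ _ => hG.colorsAt_ncard_le_three edgesAvoiding_subset c z
    omega
  by_cases hcov : Covered (edgesAvoiding G Y) c w
  · obtain ⟨f, hf, h0, z, rfl⟩ := hcov
    have hzy : z ≠ y := by rintro rfl; exact hf.2 _ hy (by simp)
    obtain ⟨t, -, ht⟩ := exists_colorsNear_ncard_le_add (E := edgesAvoiding G Y) (c := c) h3 hwy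
      (show G.Adj w z from hf.1) hzy
    have h1 := (Covered.colorsAt_ncard_lt ⟨_, hf, h0, by simp⟩ :
      (colorsAt (edgesAvoiding G Y) c w).ncard < _)
    have h2 := hG.colorsAt_ncard_le_two edgesAvoiding_subset (c := c) (z := z)
      fun _ => ⟨_, hf, h0, by simp⟩
    have := hG.colorsAt_ncard_le_three edgesAvoiding_subset (E := edgesAvoiding G Y) c t
    omega
  · have := colorsNear_ncard_le_mul (E := edgesAvoiding G Y) (c := c) hwy (n := 2) (by omega)
      fun z hz _ => hG.colorsAt_ncard_le_two_of_not_covered hmax hw hw3 hcov hz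
    omega

theorem MinCounter.colorsNear_ncard_le_four (hG : MinCounter V G) {Y : Set V}
    {c : Sym2 V → Fin 8} (hmax : ZeroMaximal G (edgesAvoiding G Y) c) {w y u : V} (hw : w ∉ Y)
    (hy : y ∈ Y) (hwy : G.Adj w y) (hwu : G.Adj w u) (huy : u ≠ y)
    (hu : (edgesAt (edgesAvoiding G Y) u).ncard ≤ 2) :
    (colorsNear G (edgesAvoiding G Y) c w y).ncard ≤ 4 := by
  have h3 := hG.1 w
  have hu' := (colorsAt_ncard_le_of_mem (E := edgesAvoiding G Y) (c := c) u).trans hu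
  by_cases hw3 : (G.neighborSet w).ncard = 3
  swap
  · have := colorsNear_ncard_le_mul (E := edgesAvoiding G Y) (c := c) hwy (n := 1) (by omega)
      fun z _ _ => hG.colorsAt_ncard_le_three edgesAvoiding_subset c z
    omega
  by_cases hcov : Covered (edgesAvoiding G Y) c w
  · obtain ⟨f, hf, h0, z, rfl⟩ := hcov
    have hzy : z ≠ y := by rintro rfl; exact hf.2 _ hy (by simp)
    obtain ⟨t, htu, ht⟩ := exists_colorsNear_ncard_le_add (E := edgesAvoiding G Y) (c := c) h3 hwy
      (show G.Adj w z from hf.1) hzy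
    have hz : Covered (edgesAvoiding G Y) c z := ⟨_, hf, h0, by simp⟩
    have h1 := hG.colorsAt_ncard_le_two edgesAvoiding_subset (c := c) fun _ => hz
    have h2 := hG.colorsAt_ncard_le_three edgesAvoiding_subset (E := edgesAvoiding G Y) c t
    have h3 := hz.colorsAt_ncard_lt
    rcases htu u hwu huy with rfl | rfl <;> omega
  · exact colorsNear_ncard_le_mul (E := edgesAvoiding G Y) (c := c) hwy (n := 2) (by omega)
      fun z hz _ => hG.colorsAt_ncard_le_two_of_not_covered hmax hw hw3 hcov hz

/-- A vertex of degree 3 in a minimal counterexample has at most one neighbor of degree 2. -/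
theorem MinCounter.eq_of_adj_of_ncard_eq_two (hG : MinCounter V G) {x y₁ y₂ : V}
    (hx3 : (G.neighborSet x).ncard = 3) (hxy₁ : G.Adj x y₁) (hxy₂ : G.Adj x y₂)
    (hd₁ : (G.neighborSet y₁).ncard = 2) (hd₂ : (G.neighborSet y₂).ncard = 2) : y₁ = y₂ := by
  classical
  by_contra hy
  obtain ⟨g, hg₁, hg₂, hx⟩ := eq_triple_of_ncard_eq_three (s := G.neighborSet x) hxy₁ hxy₂ hy hx3
  obtain ⟨w₁, hw₁, hy₁⟩ := eq_pair_of_ncard_eq_two (s := G.neighborSet y₁) hxy₁.symm hd₁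
  obtain ⟨w₂, hw₂, hy₂⟩ := eq_pair_of_ncard_eq_two (s := G.neighborSet y₂) hxy₂.symm hd₂
  have ax : ∀ z, G.Adj x z ↔ z = y₁ ∨ z = y₂ ∨ z = g := fun z => by
    rw [← mem_neighborSet, hx]; simp
  have ay₁ : ∀ z, G.Adj y₁ z ↔ z = x ∨ z = w₁ := fun z => by rw [← mem_neighborSet, hy₁]; simp
  have ay₂ : ∀ z, G.Adj y₂ z ↔ z = x ∨ z = w₂ := fun z => by rw [← mem_neighborSet, hy₂]; simp
  have hgx : g ≠ x := ((ax g).2 (by simp)).ne.symm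
  have hadj : ¬G.Adj y₁ y₂ := by
    intro h
    have h1 : w₁ = y₂ := (((ay₁ y₂).1 h).resolve_left hxy₂.ne.symm).symm
    have h2 : w₂ = y₁ := (((ay₂ y₁).1 h.symm).resolve_left hxy₁.ne.symm).symm
    have hcut := hG.two_le_ncard_edgeCut (X := {x, y₁, y₂}) ⟨x, by simp⟩
      ⟨g, by simp [hg₁, hg₂, hgx]⟩
    have hsub : edgeCut G {x, y₁, y₂} ⊆ {s(x, g)} := by
      rintro e ⟨he, a, ha, b, hb, rfl⟩
      simp only [Set.mem_insert_iff, Set.mem_singleton_iff, not_or] at ha hb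
      rw [mem_edgeSet] at he
      rcases ha with rfl | rfl | rfl
      · rcases (ax b).1 he with rfl | rfl | rfl
        · exact absurd rfl hb.2.1
        · exact absurd rfl hb.2.2
        · rfl
      · rcases (ay₁ b).1 he with rfl | rfl
        · exact absurd rfl hb.1
        · exact absurd h1 hb.2.2
      · rcases (ay₂ b).1 he with rfl | rfl
        · exact absurd rfl hb.1
        · exact absurd h2 hb.2.1
    have := Set.ncard_le_ncard hsub
    rw [Set.ncard_singleton] at this
    omega
  have hyw₁ : G.Adj y₁ w₁ := (ay₁ w₁).2 (by simp)
  have hyw₂ : G.Adj y₂ w₂ := (ay₂ w₂).2 (by simp)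
  have hw₁₂ : w₁ ≠ y₂ := by rintro rfl; exact hadj hyw₁
  have hw₂₁ : w₂ ≠ y₁ := by rintro rfl; exact hadj hyw₂.symm
  have hw₁Y : w₁ ∉ ({y₁, y₂} : Set V) := by simp [hw₁₂, hyw₁.ne.symm]
  have hw₂Y : w₂ ∉ ({y₁, y₂} : Set V) := by simp [hw₂₁, hyw₂.ne.symm]
  have hxY : x ∉ ({y₁, y₂} : Set V) := by simp [hxy₁.ne, hxy₂.ne]
  have hgY : g ∉ ({y₁, y₂} : Set V) := by simp [hg₁, hg₂]
  have hy₁Y : y₁ ∈ ({y₁, y₂} : Set V) := by simp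
  have hy₂Y : y₂ ∈ ({y₁, y₂} : Set V) := by simp
  obtain ⟨c, hc, hmax⟩ := exists_maximal_partialGood
    (hG.exists_partialGood_edgesAvoiding hy₁Y hxy₁.symm)
  suffices ∃ c, PartialGood G G.edgeSet c from hG.not_partialGood _ this.choose_spec
  set E := edgesAvoiding G {y₁, y₂} with hE
  have hEG : E ⊆ G.edgeSet := edgesAvoiding_subset
  have hxE : ∀ e ∈ E, x ∈ e → e = s(x, g) := by
    rintro e he ⟨z, rfl⟩
    rcases (ax z).1 he.1 with rfl | rfl | rfl
    · exact absurd (by simp) (he.2 _ hy₁Y)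
    · exact absurd (by simp) (he.2 _ hy₂Y)
    · rfl
  have hcx : (colorsAt E c x).ncard ≤ 1 := by
    refine (colorsAt_ncard_le_of_mem x).trans ?_
    rw [Set.ncard_le_one (Set.toFinite _)]
    intro a ha b hb
    rw [hxE a ha.1 ha.2, hxE b hb.1 hb.2]
  have hcg : (colorsAt E c g).ncard ≤ 2 := by
    refine hG.colorsAt_ncard_le_two hEG fun h3 => ?_
    rcases hmax x g (mk_mem_edgesAvoiding ((ax g).2 (by simp)) hxY hgY) hx3 h3 with h | h
    · obtain ⟨f, hf, h0, hxf⟩ := h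
      exact ⟨f, hf, h0, by rw [hxE f hf hxf]; simp⟩
    · exact h
  have hb₁ := hG.colorsNear_bound hmax hw₁Y hy₁Y hyw₁.symm
  have hb₂ := hG.colorsNear_bound hmax hw₂Y hy₂Y hyw₂.symm
  rw [← hE] at hb₁ hb₂
  have hP := le_freeColors_ncard (colorsNear G E c w₁ y₁ ∪ colorsAt E c x)
  have hQ := le_freeColors_ncard (colorsNear G E c w₂ y₂ ∪ colorsAt E c x)
  have hA := le_freeColors_ncard (colorsAt E c g ∪ colorsAt E c w₁)
  have hB := le_freeColors_ncard (colorsAt E c g ∪ colorsAt E c w₂)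
  have hP' := Set.ncard_union_le (colorsNear G E c w₁ y₁) (colorsAt E c x)
  have hQ' := Set.ncard_union_le (colorsNear G E c w₂ y₂) (colorsAt E c x)
  have hA' := Set.ncard_union_le (colorsAt E c g) (colorsAt E c w₁)
  have hB' := Set.ncard_union_le (colorsAt E c g) (colorsAt E c w₂)
  have hsel : ∃ p ∈ freeColors (colorsNear G E c w₁ y₁ ∪ colorsAt E c x),
      ∃ q ∈ freeColors (colorsNear G E c w₂ y₂ ∪ colorsAt E c x),
      (w₁ = w₂ ∨ G.Adj w₁ w₂ → p ≠ q) ∧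
      ∃ i ∈ freeColors (colorsAt E c g ∪ colorsAt E c w₁) \ {p, q},
      ∃ j ∈ freeColors (colorsAt E c g ∪ colorsAt E c w₂) \ {p, q}, i ≠ j := by
    by_cases hw : w₁ = w₂ ∨ G.Adj w₁ w₂
    swap
    · obtain ⟨p, hp, q, hq, h⟩ := exists_selection (α := Fin 8)
        (P := freeColors (colorsNear G E c w₁ y₁ ∪ colorsAt E c x))
        (Q := freeColors (colorsNear G E c w₂ y₂ ∪ colorsAt E c x))
        (A := freeColors (colorsAt E c g ∪ colorsAt E c w₁))
        (B := freeColors (colorsAt E c g ∪ colorsAt E c w₂)) (by omega) (by omega)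
      exact ⟨p, hp, q, hq, fun h => absurd h hw, h⟩
    have hlt₁ := edgesAt_ncard_lt hEG (e := s(y₁, w₁)) hyw₁ (z := w₁) (by simp)
      fun h => h.2 _ hy₁Y (by simp)
    have hlt₂ := edgesAt_ncard_lt hEG (e := s(y₂, w₂)) hyw₂ (z := w₂) (by simp)
      fun h => h.2 _ hy₂Y (by simp)
    have h3₁ := hG.1 w₁
    have h3₂ := hG.1 w₂
    have hw₁0 : (edgesAt E w₁).ncard ≤ 2 := by omega
    have hw₂0 : (edgesAt E w₂).ncard ≤ 2 := by omega
    have hy₁0 : (edgesAt E y₁).ncard ≤ 2 := (edgesAt_ncard_le hEG y₁).trans hd₁.le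
    have hy₂0 : (edgesAt E y₂).ncard ≤ 2 := (edgesAt_ncard_le hEG y₂).trans hd₂.le
    have hn : (colorsNear G E c w₁ y₁).ncard ≤ 4 ∧ (colorsNear G E c w₂ y₂).ncard ≤ 4 ∧
        ((colorsAt E c w₁).ncard ≤ 1 ∨ (colorsAt E c w₂).ncard ≤ 1) := by
      rcases hw with hw | hw
      · have hw₁y₂ : G.Adj w₁ y₂ := hw ▸ hyw₂.symm
        have hw₂y₁ : G.Adj w₂ y₁ := hw ▸ hyw₁.symm
        refine ⟨hG.colorsNear_ncard_le_four hmax hw₁Y hy₁Y hyw₁.symm hw₁y₂ (Ne.symm hy) hy₂0,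
          hG.colorsNear_ncard_le_four hmax hw₂Y hy₂Y hyw₂.symm hw₂y₁ hy hy₁0, Or.inl ?_⟩
        have h1 : s(w₁, y₁) ∉ E := fun h => h.2 _ hy₁Y (by simp)
        have h2 := edgesAt_ncard_lt (E := insert s(w₁, y₁) E) (Set.insert_subset hyw₁.symm hEG)
          (e := s(w₁, y₂)) hw₁y₂ (z := w₁) (by simp) (by
            rintro (h | h)
            · exact hy (Sym2.congr_right.1 h).symm
            · exact h.2 _ hy₂Y (by simp))
        have h4 : edgesAt (insert s(w₁, y₁) E) w₁ = insert s(w₁, y₁) (edgesAt E w₁) := by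
          ext e
          constructor
          · rintro ⟨rfl | h, h'⟩
            · exact Or.inl rfl
            · exact Or.inr ⟨h, h'⟩
          · rintro (rfl | ⟨h, h'⟩)
            · exact ⟨Or.inl rfl, by simp⟩
            · exact ⟨Or.inr h, h'⟩
        rw [h4, Set.ncard_insert_of_notMem fun h => h1 h.1] at h2
        have := colorsAt_ncard_le_of_mem (E := E) (c := c) w₁
        omega
      · refine ⟨hG.colorsNear_ncard_le_four hmax hw₁Y hy₁Y hyw₁.symm hw hw₂₁ hw₂0,
          hG.colorsNear_ncard_le_four hmax hw₂Y hy₂Y hyw₂.symm hw.symm hw₁₂ hw₁0, ?_⟩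
        have ha₁ := colorsAt_ncard_le_of_mem (E := E) (c := c) w₁
        have ha₂ := colorsAt_ncard_le_of_mem (E := E) (c := c) w₂
        by_cases h₁ : (G.neighborSet w₁).ncard = 3
        · by_cases h₂ : (G.neighborSet w₂).ncard = 3
          · rcases hmax w₁ w₂ (mk_mem_edgesAvoiding hw hw₁Y hw₂Y) h₁ h₂ with h | h
            · have := h.colorsAt_ncard_lt
              omega
            · have := h.colorsAt_ncard_lt
              omega
          · omega
        · omega
    obtain ⟨p, hp, q, hq, hpq, h⟩ := exists_selection_ne (α := Fin 8)
      (P := freeColors (colorsNear G E c w₁ y₁ ∪ colorsAt E c x))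
      (Q := freeColors (colorsNear G E c w₂ y₂ ∪ colorsAt E c x))
      (A := freeColors (colorsAt E c g ∪ colorsAt E c w₁))
      (B := freeColors (colorsAt E c g ∪ colorsAt E c w₂)) (by omega) (by omega) (by omega)
      (by omega) (by omega)
    exact ⟨p, hp, q, hq, fun _ => hpq, h⟩
  obtain ⟨p, hp, q, hq, hpq, i, ⟨hi, hi'⟩, j, ⟨hj, hj'⟩, hij⟩ := hsel
  simp only [mem_freeColors, Set.mem_union, not_or, Set.mem_insert_iff, Set.mem_singleton_iff]
    at hp hq hi hj hi' hj'
  exact hc.extend_four hy hx hy₁ hy₂ hw₁ hw₂ hw₁₂ hw₂₁ hp.1 hq.1 hi.1 hj.1 hp.2.1 hp.2.2 hq.2.1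
    hq.2.2 hpq hi.2.1 hi.2.2 hi'.1 hi'.2 hj.2.1 hj.2.2 hj'.1 hj'.2 hij

end TwoVertices

section Greedy

variable {V : Type} {G : SimpleGraph V}

/-- A vertex of degree 3 that lies on no edge of `M`. -/
def Uncovered (G : SimpleGraph V) (M : Set (Sym2 V)) (x : V) : Prop :=
  (G.neighborSet x).ncard = 3 ∧ ∀ e ∈ M, x ∉ e

/-- A matching on the vertices of degree 3 whose uncovered vertices are pairwise nonadjacent, have
neighbors of degree 2, and do not share such neighbors. -/
structure IsCubicMatching (G : SimpleGraph V) (M : Set (Sym2 V)) : Prop where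
  subset : M ⊆ G.edgeSet
  notMem : ∀ e ∈ M, ∀ f ∈ M, e ≠ f → ∀ a ∈ e, a ∉ f
  ncard_eq : ∀ e ∈ M, ∀ a ∈ e, (G.neighborSet a).ncard = 3
  exists_adj : ∀ x, Uncovered G M x → ∃ t, G.Adj x t ∧ (G.neighborSet t).ncard = 2
  eq_of_adj : ∀ x x' t, Uncovered G M x → Uncovered G M x' → (G.neighborSet t).ncard = 2 →
    G.Adj x t → G.Adj x' t → x = x'
  not_adj : ∀ x x', Uncovered G M x → Uncovered G M x' → ¬G.Adj x x'

theorem exists_adj_dist_add_one (hconn : G.Connected) {u v : V} (huv : u ≠ v) :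
    ∃ w, G.Adj u w ∧ G.dist v w + 1 = G.dist v u := by
  obtain ⟨p, hp⟩ := hconn.exists_walk_length_eq_dist u v
  cases p with
  | nil => exact absurd rfl huv
  | cons h p =>
    rename_i w
    refine ⟨w, h, ?_⟩
    have h1 := dist_le p
    have h2 := hconn.dist_triangle (u := u) (v := w) (w := v)
    rw [dist_eq_one_iff_adj.2 h] at h2
    rw [Walk.length_cons] at hp
    rw [dist_comm (u := v), dist_comm (u := v)]
    omega

/-- The sum of the distances from `v` to the ends of an edge. -/
noncomputable def distSum (G : SimpleGraph V) (v : V) : Sym2 V → ℤ :=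
  Sym2.lift ⟨fun a b => G.dist v a + G.dist v b, fun _ _ => add_comm _ _⟩

variable [Finite V]

/-- Color the edges outside `M` greedily in the order given by `key`. -/
theorem exists_partialGood_of_key {M : Set (Sym2 V)} {c₀ : Sym2 V → Fin 8}
    (hMG : M ⊆ G.edgeSet) (hM : PartialGood G M c₀) (hc₀ : ∀ e ∈ M, c₀ e = 0) (key : Sym2 V → ℤ)
    (hkey : ∀ S ⊆ G.edgeSet \ M, ∀ e ∈ G.edgeSet \ M, e ∉ S → (∀ f ∈ S, key f ≤ key e) →
      ∀ c : Sym2 V → Fin 8, (∀ f ∈ M, c f = 0) → ∃ x y, e = s(x, y) ∧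
        (colorsNear G (M ∪ S) c x y).ncard + (colorsNear G (M ∪ S) c y x).ncard ≤ 6) :
    ∃ c, PartialGood G G.edgeSet c := by
  classical
  have key' : ∀ S : Finset (Sym2 V), ↑S ⊆ G.edgeSet \ M →
      ∃ c, PartialGood G (M ∪ S) c ∧ ∀ f ∈ M, c f = 0 := by
    intro S
    induction S using Finset.induction_on_max_value key with
    | empty => exact fun _ => ⟨c₀, by simpa using hM, hc₀⟩
    | insert e S he hmax ih =>
      intro hS
      rw [Finset.coe_insert, Set.insert_subset_iff] at hS
      obtain ⟨c, hc, hcM⟩ := ih hS.2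
      obtain ⟨x, y, rfl, h6⟩ := hkey S hS.2 e hS.1 (by simpa using he) (by simpa using hmax) c hcM
      obtain ⟨i, hi, hi1, hi2⟩ := exists_color h6
      refine ⟨Function.update c s(x, y) i, ?_, fun f hf => ?_⟩
      · rw [Finset.coe_insert, Set.union_insert]
        exact hc.insert_edge (Set.union_subset hMG fun f hf => (hS.2 hf).1)
          (by rintro (h | h); exacts [hS.1.2 h, he (by simpa using h)]) hi hi1 hi2
      · rw [Function.update_of_ne (by rintro rfl; exact hS.1.2 hf), hcM f hf]
  obtain ⟨c, hc, -⟩ := key' (Set.toFinite (G.edgeSet \ M)).toFinset (by simp)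
  rw [Set.Finite.coe_toFinset, Set.union_sdiff_cancel hMG] at hc
  exact ⟨c, hc⟩

theorem IsCubicMatching.exists_partialGood {M : Set (Sym2 V)} (hM : IsCubicMatching G M)
    (hconn : G.Connected)
    (hdeg : ∀ z, (G.neighborSet z).ncard = 2 ∨ (G.neighborSet z).ncard = 3) {v : V}
    (hv : (G.neighborSet v).ncard = 2) : ∃ c, PartialGood G G.edgeSet c := by
  classical
  let cubic : Sym2 V → Prop := fun e => ∀ a ∈ e, (G.neighborSet a).ncard = 3
  let late : Sym2 V → Prop := fun e =>
    ∃ a b, e = s(a, b) ∧ Uncovered G M a ∧ (G.neighborSet b).ncard = 2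
  have hcov : ∀ {S : Set (Sym2 V)} {z : V}, S ⊆ G.edgeSet \ M → ¬Uncovered G M z →
      (edgesAt S z).ncard ≤ 2 := by
    intro S z hS hz
    have h1 := edgesAt_ncard_le (fun e he => (hS he).1 : S ⊆ G.edgeSet) z
    rcases hdeg z with h2 | h3
    · omega
    · obtain ⟨e, he, hze⟩ : ∃ e ∈ M, z ∈ e := by
        by_contra! h
        exact hz ⟨h3, h⟩
      have := edgesAt_ncard_lt (fun e he => (hS he).1 : S ⊆ G.edgeSet) (hM.subset he) hze
        fun h => (hS h).2 he
      omega
  have huncov : ∀ {S : Set (Sym2 V)} {z : V}, S ⊆ G.edgeSet \ M → (∀ f ∈ S, ¬late f) →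
      (edgesAt S z).ncard ≤ 2 := by
    intro S z hS hlate
    by_cases hz : Uncovered G M z
    · obtain ⟨t, hzt, ht⟩ := hM.exists_adj z hz
      have := edgesAt_ncard_lt (fun e he => (hS he).1 : S ⊆ G.edgeSet) (e := s(z, t)) hzt (z := z)
        (by simp) fun h => hlate _ h ⟨z, t, rfl, hz, ht⟩
      have := hz.1
      omega
    · exact hcov hS hz
  refine exists_partialGood_of_key (c₀ := fun _ => 0) hM.subset
    ⟨fun e he f hf hne _ _ => hM.notMem e he f hf hne, fun _ _ _ _ _ _ h => absurd rfl h,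
      fun e he _ => hM.ncard_eq e he⟩ (fun _ _ => rfl)
    (fun e => if cubic e then -distSum G v e - 1 else if late e then 1 else 0) ?_
  intro S hS e he heS hmax c hc
  have hat : ∀ z, (colorsAt (M ∪ S) c z).ncard ≤ (edgesAt S z).ncard := fun z =>
    colorsAt_ncard_le_edgesAt fun f hf => hf.symm.imp id (hc f)
  have hsum : ∀ a b, distSum G v s(a, b) = G.dist v a + G.dist v b := fun _ _ => rfl
  have hpos : ∀ f, 0 ≤ distSum G v f := by
    intro f
    induction f with
    | h a b => rw [hsum]; positivity
  have hfar : ∀ {x y : V}, G.Adj x y → (∀ z, G.Adj x z → z ≠ y → (edgesAt S z).ncard ≤ 2) →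
      (colorsNear G (M ∪ S) c x y).ncard + 4 ≤ 2 * (G.neighborSet x).ncard + 2 := by
    intro x y hxy hz
    have h := colorsNear_ncard_le_mul (E := M ∪ S) (c := c) hxy
      (n := (G.neighborSet x).ncard - 1) (k := 2) (by omega)
      fun z hxz hzy => (hat z).trans (hz z hxz hzy)
    have := hdeg x
    omega
  by_cases hcub : cubic e
  · simp only [hcub, if_true] at hmax
    have hS' : ∀ f ∈ S, cubic f ∧ distSum G v e ≤ distSum G v f := by
      intro f hf
      have h1 := hmax f hf
      have h2 := hpos e
      split_ifs at h1 with h3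
      · exact ⟨h3, by omega⟩
      · omega
      · omega
    have h2 : ∀ z, (edgesAt S z).ncard ≤ 2 := fun z => huncov hS fun f hf => by
      rintro ⟨a, b, rfl, -, hb⟩
      have := (hS' _ hf).1 b (by simp)
      omega
    obtain ⟨x, y, rfl, hxy⟩ : ∃ x y, e = s(x, y) ∧ G.dist v y ≤ G.dist v x := by
      induction e with
      | h a b =>
        rcases le_total (G.dist v b) (G.dist v a) with h | h
        · exact ⟨a, b, rfl, h⟩
        · exact ⟨b, a, Sym2.eq_swap, h⟩
    have hx3 := hcub x (by simp)
    have hy3 := hcub y (by simp)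
    have hadj : G.Adj x y := he.1
    have hx := hfar hadj fun z _ _ => h2 z
    obtain ⟨w, hyw, hw⟩ := exists_adj_dist_add_one hconn (u := y) (v := v)
      (by rintro rfl; omega)
    have hwx : w ≠ x := by rintro rfl; omega
    have hw0 : colorsAt (M ∪ S) c w = ∅ := by
      rw [← Set.ncard_eq_zero, ← Nat.le_zero]
      refine (hat w).trans ?_
      rw [Nat.le_zero, Set.ncard_eq_zero, Set.eq_empty_iff_forall_notMem]
      rintro f ⟨hf, z, rfl⟩
      have h3 := (hS' _ hf).2
      have h4 : G.Adj w z := (hS hf).1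
      have h5 := hconn.dist_triangle (u := v) (v := w) (w := z)
      rw [dist_eq_one_iff_adj.2 h4] at h5
      change distSum G v s(x, y) ≤ distSum G v s(w, z) at h3
      rw [hsum, hsum] at h3
      omega
    have hy := colorsNear_ncard_le (G := G) (E := M ∪ S) (c := c) (x := y) (y := x)
      (s := (G.neighborSet y \ {x}) \ {w}) (n := 1) (k := 2) (by
        have h3 := neighborSet_diff_ncard hadj.symm
        have h4 := Set.ncard_sdiff_singleton_add_one
          (show w ∈ G.neighborSet y \ {x} from ⟨hyw, hwx⟩)
        omega) (by
        intro z hyz hzx hz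
        by_cases hzw : z = w
        · rw [hzw, hw0]
        · exact absurd ⟨⟨hyz, hzx⟩, hzw⟩ hz) fun z _ => (hat z).trans (h2 z)
    exact ⟨x, y, rfl, by omega⟩
  by_cases hlate : late e
  · obtain ⟨x, y, rfl, hx, hy⟩ := hlate
    have hadj : G.Adj x y := he.1
    have h1 := hfar hadj fun z hxz _ => hcov hS fun hz => hM.not_adj x z hx hz hxz
    have h2 := hfar hadj.symm fun z hyz hzx => hcov hS fun hz =>
      hzx (hM.eq_of_adj z x y hz hx hy hyz.symm hadj)
    have := hx.1
    exact ⟨x, y, rfl, by omega⟩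
  · simp only [hcub, hlate, if_false] at hmax
    have h2 : ∀ z, (edgesAt S z).ncard ≤ 2 := fun z => huncov hS fun f hf hf' => by
      have h1 := hmax f hf
      have h3 : ¬cubic f := by
        obtain ⟨a, b, rfl, -, hb⟩ := hf'
        intro h
        have := h b (by simp)
        omega
      simp only [h3, hf', if_false, if_true] at h1
      omega
    obtain ⟨y, ⟨x, rfl⟩, hy⟩ : ∃ y ∈ e, (G.neighborSet y).ncard ≠ 3 := by
      simpa [cubic] using hcub
    have hadj : G.Adj y x := he.1
    have h3 := hfar hadj fun z _ _ => h2 z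
    have h4 := hfar hadj.symm fun z _ _ => h2 z
    have h5 := hdeg x
    have h6 := hdeg y
    exact ⟨y, x, rfl, by omega⟩

end Greedy

section PerfectMatching

/-- A graph of even order has a perfect matching if, apart from a clique, it has maximum degree at
most 3 and odd sets of vertices have at least 3 outgoing edges. -/
theorem exists_isPerfectMatching_of_isClique {W : Type} [Finite W] {H : SimpleGraph W} {T : Set W}
    (hcard : Even (Nat.card W)) (hT : H.IsClique T)
    (hdeg : ∀ w, {z | z ∉ T ∧ H.Adj z w}.ncard ≤ 3)
    (hcut : ∀ K : Set W, Disjoint K T → Odd K.ncard →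
      3 ≤ {p : W × W | p.1 ∈ K ∧ p.2 ∉ K ∧ H.Adj p.1 p.2}.ncard) :
    ∃ M : H.Subgraph, M.IsPerfectMatching := by
  classical
  have := Fintype.ofFinite W
  rw [tutte]
  intro S hS
  unfold IsTutteViolator at hS
  set H' := ((⊤ : H.Subgraph).deleteVerts S).coe with hH'
  have hadj : ∀ {a b : ((⊤ : H.Subgraph).deleteVerts S).verts}, H'.Adj a b ↔ H.Adj a b := by
    rintro ⟨a, ha⟩ ⟨b, hb⟩
    simp only [Subgraph.deleteVerts_verts, Subgraph.verts_top, Set.mem_sdiff, Set.mem_univ,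
      true_and] at ha hb
    simp [hH', ha, hb]
  let vert : H'.ConnectedComponent → Set W := fun c => Subtype.val '' c.supp
  have hvert : ∀ {c : H'.ConnectedComponent} {a b : W}, a ∈ vert c → b ∉ S → H.Adj a b →
      b ∈ vert c := by
    rintro c _ b ⟨a, ha, rfl⟩ hb hab
    refine ⟨⟨b, by simpa using hb⟩, ?_, rfl⟩
    rw [ConnectedComponent.mem_supp_iff] at ha ⊢
    rw [← ha]
    exact ConnectedComponent.sound (hadj.2 hab.symm).reachable
  have hinj : ∀ {c c' : H'.ConnectedComponent} {a : W}, a ∈ vert c → a ∈ vert c' → c = c' := by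
    rintro c c' _ ⟨a, ha, rfl⟩ ⟨b, hb, hab⟩
    rw [Subtype.val_injective hab] at hb
    exact ha.symm.trans hb
  have hnotMem : ∀ {c : H'.ConnectedComponent} {a : W}, a ∈ vert c → a ∉ S := by
    rintro c _ ⟨⟨a, ha⟩, -, rfl⟩
    simpa using ha
  let O : Finset H'.ConnectedComponent := H'.oddComponents.toFinite.toFinset
  let O' : Finset H'.ConnectedComponent := {c ∈ O | Disjoint (vert c) T}
  have hO : O.card = H'.oddComponents.ncard := (Set.ncard_eq_toFinset_card _).symm
  have hOO' : O.card ≤ O'.card + 1 := by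
    rw [← Finset.card_filter_add_card_filter_not (s := O) (fun c => Disjoint (vert c) T)]
    refine Nat.add_le_add_left (Finset.card_le_one.2 fun c hc c' hc' => ?_) _
    rw [Finset.mem_filter, Set.not_disjoint_iff] at hc hc'
    obtain ⟨-, a, ha, haT⟩ := hc
    obtain ⟨-, b, hb, hbT⟩ := hc'
    by_cases hab : a = b
    · exact hinj ha (hab ▸ hb)
    · exact hinj (hvert ha (hnotMem hb) (hT haT hbT hab)) hb
  let D : Finset (W × W) := {p | p.1 ∉ T ∧ p.2 ∈ S ∧ H.Adj p.1 p.2}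
  have hD : D.card ≤ 3 * S.toFinite.toFinset.card := by
    refine Finset.card_le_mul_card_image_of_maps_to (f := Prod.snd) (fun p hp => ?_) 3 fun w _ => ?_
    · simpa using (Finset.mem_filter.1 hp).2.2.1
    · refine le_trans ?_ (hdeg w)
      rw [← Set.ncard_coe_finset]
      refine Set.ncard_le_ncard_of_injOn Prod.fst ?_ ?_
      · rintro ⟨a, b⟩ hab
        simp only [D, Finset.coe_filter, Finset.mem_filter, Finset.mem_univ, true_and,
          Set.mem_ofPred_eq] at hab ⊢
        obtain ⟨⟨h1, h2, h3⟩, rfl⟩ := hab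
        exact ⟨h1, h3⟩
      · rintro ⟨a, b⟩ hab ⟨a', b'⟩ hab' h
        have h1 := (Finset.mem_filter.1 hab).2
        have h2 := (Finset.mem_filter.1 hab').2
        exact Prod.ext h (h1.trans h2.symm)
  have hO'D : O'.card * 3 ≤ D.card * 1 := by
    refine Finset.card_mul_le_card_mul (fun c p => p.1 ∈ vert c) (fun c hc => ?_) fun p _ => ?_
    · obtain ⟨hc, hcT⟩ := Finset.mem_filter.1 hc
      have hodd : Odd (vert c).ncard := by
        rw [Set.ncard_image_of_injective _ Subtype.val_injective]
        simpa [O] using hc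
      refine (hcut _ hcT hodd).trans ?_
      rw [← Set.ncard_coe_finset]
      refine Set.ncard_le_ncard ?_
      rintro ⟨a, b⟩ ⟨ha, hb, hab⟩
      simp only [Finset.coe_bipartiteAbove, Set.mem_ofPred_eq, D, Finset.mem_filter,
        Finset.mem_univ, true_and]
      exact ⟨⟨hcT.notMem_of_mem_left ha, by_contra fun h => hb (hvert ha h hab), hab⟩, ha⟩
    · refine Finset.card_le_one.2 fun c hc c' hc' => ?_
      exact hinj ((Finset.mem_bipartiteBelow _).1 hc).2 ((Finset.mem_bipartiteBelow _).1 hc').2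
  have hpar := odd_ncard_oddComponents H'
  have hverts : Nat.card ((⊤ : H.Subgraph).deleteVerts S).verts + S.ncard = Nat.card W := by
    have : ((⊤ : H.Subgraph).deleteVerts S).verts = Sᶜ := by ext; simp
    rw [this, Nat.card_coe_set_eq, add_comm, Set.ncard_add_ncard_compl]
  rw [← Set.ncard_eq_toFinset_card] at hD
  rw [← hverts] at hcard
  have hSO : H'.oddComponents.ncard = S.ncard + 1 := by omega
  rw [hSO] at hpar
  grind

end PerfectMatching

section Cubic

variable {V : Type} {G : SimpleGraph V} [Finite V]

/-- In an odd set of vertices of degree 3, the number of outgoing edges is odd. -/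
theorem odd_ncard_of_odd_ncard {X : Set V} (hX : ∀ x ∈ X, (G.neighborSet x).ncard = 3)
    (hodd : Odd X.ncard) : Odd {p : V × V | p.1 ∈ X ∧ p.2 ∉ X ∧ G.Adj p.1 p.2}.ncard := by
  classical
  have := Fintype.ofFinite V
  let P : Finset (V × V) := {p | p.1 ∈ X ∧ G.Adj p.1 p.2}
  have hP : P.card = 3 * X.ncard := by
    rw [Finset.card_eq_sum_card_fiberwise (f := Prod.fst) (t := X.toFinite.toFinset) (by
      intro p hp; simpa using (Finset.mem_filter.1 hp).2.1), Set.ncard_eq_toFinset_card X, mul_comm]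
    refine Finset.sum_const_nat fun x hx => ?_
    rw [Set.Finite.mem_toFinset] at hx
    rw [← hX x hx, ← Set.ncard_coe_finset]
    refine Set.ncard_congr (fun p _ => p.2) ?_ ?_ ?_
    · rintro ⟨a, b⟩ h
      obtain ⟨h1, rfl⟩ := Finset.mem_filter.1 h
      exact (Finset.mem_filter.1 h1).2.2
    · rintro ⟨a, b⟩ ⟨a', b'⟩ h h' hb
      exact Prod.ext ((Finset.mem_filter.1 h).2.trans (Finset.mem_filter.1 h').2.symm) hb
    · intro b hb
      exact ⟨(x, b), by simpa [P] using ⟨hx, hb⟩, rfl⟩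
  have heven : Even (P.filter fun p => p.2 ∈ X).card := by
    rw [← ZMod.natCast_eq_zero_iff_even, Finset.cast_card]
    refine Finset.sum_involution (fun p _ => p.swap) (fun _ _ => by decide) (fun p hp _ h => ?_)
      (fun p hp => ?_) fun p _ => p.swap_swap
    · have hadj := (Finset.mem_filter.1 (Finset.mem_filter.1 hp).1).2.2
      exact hadj.ne (congrArg Prod.snd h)
    · obtain ⟨h, h2⟩ := Finset.mem_filter.1 hp
      obtain ⟨-, h1, h3⟩ := Finset.mem_filter.1 h
      simpa [P] using ⟨⟨h2, h3.symm⟩, h1⟩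
  have hcut : {p : V × V | p.1 ∈ X ∧ p.2 ∉ X ∧ G.Adj p.1 p.2}.ncard =
      (P.filter fun p => p.2 ∉ X).card := by
    rw [← Set.ncard_coe_finset]
    congr 1
    ext p
    simp [P]
    tauto
  have h := Finset.card_filter_add_card_filter_not (s := P) (fun p => p.2 ∈ X)
  rw [hcut]
  grind

theorem MinCounter.three_le_ncard_of_odd_ncard (hG : MinCounter V G) {X : Set V}
    (hX : ∀ x ∈ X, (G.neighborSet x).ncard = 3) (hodd : Odd X.ncard) (hX' : Xᶜ.Nonempty) :
    3 ≤ {p : V × V | p.1 ∈ X ∧ p.2 ∉ X ∧ G.Adj p.1 p.2}.ncard := by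
  have h1 := odd_ncard_of_odd_ncard hX hodd
  have h2 := hG.two_le_ncard_edgeCut (Set.nonempty_of_ncard_ne_zero hodd.pos.ne') hX'
  have h3 : (edgeCut G X).ncard ≤
      {p : V × V | p.1 ∈ X ∧ p.2 ∉ X ∧ G.Adj p.1 p.2}.ncard := by
    refine (Set.ncard_le_ncard ?_).trans (Set.ncard_image_le (f := fun p => s(p.1, p.2)))
    rintro _ ⟨he, a, ha, b, hb, rfl⟩
    exact ⟨(a, b), ⟨ha, hb, he⟩, rfl⟩
  grind

theorem MinCounter.connected (hG : MinCounter V G) (v : V) : G.Connected := by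
  have key : ∀ w, G.Reachable v w := by
    by_contra! h
    have h2 := hG.two_le_ncard_edgeCut (X := {z | G.Reachable v z}) ⟨v, .refl v⟩ h
    have h0 : edgeCut G {z | G.Reachable v z} = ∅ := by
      rw [Set.eq_empty_iff_forall_notMem]
      rintro _ ⟨he, a, ha, b, hb, rfl⟩
      exact hb (ha.trans he.reachable)
    simp [h0] at h2
  exact (connected_iff_exists_forall_reachable G).2 ⟨v, key⟩

/-- Two copies of `G`, with all their vertices of degree 2 joined to each other. -/
def doubled (G : SimpleGraph V) : SimpleGraph (V × Bool) where
  Adj p q := (p.2 = q.2 ∧ G.Adj p.1 q.1) ∨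
    p ≠ q ∧ (G.neighborSet p.1).ncard = 2 ∧ (G.neighborSet q.1).ncard = 2
  symm := ⟨by
    rintro p q (⟨h1, h2⟩ | ⟨h1, h2, h3⟩)
    exacts [.inl ⟨h1.symm, h2.symm⟩, .inr ⟨h1.symm, h3, h2⟩]⟩
  loopless := ⟨by rintro p (⟨-, h⟩ | ⟨h, -⟩); exacts [G.loopless.1 _ h, h rfl]⟩

theorem MinCounter.exists_matching (hG : MinCounter V G)
    (hdeg : ∀ z, (G.neighborSet z).ncard = 2 ∨ (G.neighborSet z).ncard = 3) {v : V}
    (hv : (G.neighborSet v).ncard = 2) :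
    ∃ N ⊆ G.edgeSet, (∀ e ∈ N, ∀ f ∈ N, e ≠ f → ∀ a ∈ e, a ∉ f) ∧
      ∀ x, (G.neighborSet x).ncard = 3 → ∃ e ∈ N, x ∈ e := by
  have hadj : ∀ {p q : V × Bool}, (doubled G).Adj p q ↔ (p.2 = q.2 ∧ G.Adj p.1 q.1) ∨
    p ≠ q ∧ (G.neighborSet p.1).ncard = 2 ∧ (G.neighborSet q.1).ncard = 2 := Iff.rfl
  obtain ⟨M, hM⟩ := exists_isPerfectMatching_of_isClique (H := doubled G)
    (T := {p | (G.neighborSet p.1).ncard = 2}) (by simp)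
    (fun p hp q hq hpq => .inr ⟨hpq, hp, hq⟩) (by
      rintro ⟨b, i⟩
      refine le_trans (Set.ncard_le_ncard_of_injOn Prod.fst ?_ ?_) (hG.1 b)
      · rintro ⟨a, j⟩ ⟨h1, h2⟩
        rcases hadj.1 h2 with h | h
        exacts [h.2.symm, absurd h.2.1 h1]
      · rintro ⟨a, j⟩ ⟨h1, h2⟩ ⟨a', j'⟩ ⟨h1', h2'⟩ h
        have e1 := (hadj.1 h2).resolve_right fun h => h1 h.2.1
        have e2 := (hadj.1 h2').resolve_right fun h => h1' h.2.1
        exact Prod.ext h (e1.1.trans e2.1.symm)) (by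
      intro K hK hodd
      have hK3 : ∀ p ∈ K, (G.neighborSet p.1).ncard = 3 := fun p hp =>
        (hdeg p.1).resolve_left fun h => hK.notMem_of_mem_left hp h
      have hsum : K.ncard = {a | (a, true) ∈ K}.ncard + {a | (a, false) ∈ K}.ncard := by
        have h1 : K = (fun a => (a, true)) '' {a | (a, true) ∈ K} ∪
            (fun a => (a, false)) '' {a | (a, false) ∈ K} := by
          ext ⟨a, i⟩
          cases i <;> simp
        conv_lhs => rw [h1]
        rw [Set.ncard_union_eq, Set.ncard_image_of_injective _ (Prod.mk_left_injective _),
          Set.ncard_image_of_injective _ (Prod.mk_left_injective _)]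
        rw [Set.disjoint_left]
        rintro _ ⟨a, -, rfl⟩ ⟨b, -, hb⟩
        simp at hb
      obtain ⟨i, hi⟩ : ∃ i, Odd {a | (a, i) ∈ K}.ncard := by
        by_contra! h
        have h1 := h true
        have h2 := h false
        grind
      refine (hG.three_le_ncard_of_odd_ncard (fun x hx => hK3 (x, i) hx) hi
        ⟨v, fun h => ?_⟩).trans ?_
      · exact absurd (hv.symm.trans (hK3 (v, i) h)) (by decide)
      · refine Set.ncard_le_ncard_of_injOn (fun p => ((p.1, i), (p.2, i))) ?_ ?_
        · rintro ⟨a, b⟩ ⟨ha, hb, hab⟩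
          exact ⟨ha, hb, .inl ⟨rfl, hab⟩⟩
        · rintro ⟨a, b⟩ - ⟨a', b'⟩ - h
          simpa using h)
  refine ⟨{e | ∃ a b, e = s(a, b) ∧ G.Adj a b ∧ M.Adj (a, true) (b, true)}, ?_, ?_, fun x hx => ?_⟩
  · rintro _ ⟨a, b, rfl, h, -⟩
    exact h
  · rintro _ ⟨a, b, rfl, h, hM1⟩ _ ⟨c, d, rfl, h', hM2⟩ hne z hz hz'
    have huniq : ∀ {a b b' : V}, M.Adj (a, true) (b, true) → M.Adj (a, true) (b', true) → b = b' :=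
      fun h h' => congrArg Prod.fst (hM.1.eq_of_adj_left h h')
    rw [Sym2.mem_iff] at hz hz'
    rcases hz with rfl | rfl <;> rcases hz' with rfl | rfl
    · exact hne (by simp [huniq hM1 hM2])
    · exact hne (by simp [huniq hM1 hM2.symm])
    · exact hne (by simp [huniq hM1.symm hM2])
    · exact hne (by simp [huniq hM1.symm hM2.symm])
  · obtain ⟨⟨y, i⟩, hy, -⟩ := hM.1 (hM.2 (x, true))
    obtain ⟨rfl, hxy⟩ := (hadj.1 hy.adj_sub).resolve_right fun h =>
      absurd (hx.symm.trans h.2.1) (by decide)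
    exact ⟨s(x, y), ⟨x, y, rfl, hxy, hy⟩, by simp⟩

theorem MinCounter.exists_isCubicMatching (hG : MinCounter V G)
    (hdeg : ∀ z, (G.neighborSet z).ncard = 2 ∨ (G.neighborSet z).ncard = 3) {v : V}
    (hv : (G.neighborSet v).ncard = 2) : ∃ M, IsCubicMatching G M := by
  obtain ⟨N, hNG, hN, hN3⟩ := hG.exists_matching hdeg hv
  obtain ⟨M, hle, hM⟩ := (Set.toFinite {M : Set (Sym2 V) | M ⊆ G.edgeSet ∧
    (∀ e ∈ M, ∀ f ∈ M, e ≠ f → ∀ a ∈ e, a ∉ f) ∧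
    ∀ e ∈ M, ∀ a ∈ e, (G.neighborSet a).ncard = 3}).exists_le_maximal
      (a := {e ∈ N | ∀ a ∈ e, (G.neighborSet a).ncard = 3})
      ⟨fun e he => hNG he.1, fun e he f hf => hN e he.1 f hf.1, fun e he => he.2⟩
  obtain ⟨hMG, hM1, hM3⟩ := hM.prop
  have key : ∀ x, Uncovered G M x → ∃ t, s(x, t) ∈ N ∧ (G.neighborSet t).ncard = 2 := by
    intro x hx
    obtain ⟨e, he, t, rfl⟩ := hN3 x hx.1
    refine ⟨t, he, (hdeg t).resolve_right fun ht => ?_⟩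
    refine hx.2 _ (hle ⟨he, fun a ha => ?_⟩) (Sym2.mem_mk_left x t)
    rcases Sym2.mem_iff.1 ha with rfl | rfl
    exacts [hx.1, ht]
  have key' : ∀ x t, Uncovered G M x → (G.neighborSet t).ncard = 2 → G.Adj x t → s(x, t) ∈ N := by
    intro x t hx ht hxt
    obtain ⟨t', ht', ht'2⟩ := key x hx
    rwa [hG.eq_of_adj_of_ncard_eq_two hx.1 hxt (hNG ht') ht ht'2]
  refine ⟨M, hMG, hM1, hM3, fun x hx => ?_, fun x x' t hx hx' ht hxt hxt' => ?_,
    fun x x' hx hx' hadj => ?_⟩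
  · obtain ⟨t, h1, h2⟩ := key x hx
    exact ⟨t, hNG h1, h2⟩
  · by_contra hne
    exact hN _ (key' x t hx ht hxt) _ (key' x' t hx' ht hxt') (by grind) t (by simp)
      (by simp)
  · have hnot : ∀ f ∈ M, ∀ a ∈ s(x, x'), a ∉ f := by
      intro f hf a ha
      rcases Sym2.mem_iff.1 ha with rfl | rfl
      exacts [hx.2 f hf, hx'.2 f hf]
    refine hx.2 _ (hM.le_of_ge (y := insert s(x, x') M) ⟨?_, ?_, ?_⟩ (Set.subset_insert _ _)
      (Set.mem_insert _ _)) (Sym2.mem_mk_left x x')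
    · exact Set.insert_subset hadj hMG
    · rintro e (rfl | he) f (rfl | hf) hne a ha
      · exact absurd rfl hne
      · exact hnot f hf a ha
      · exact fun h => hnot e he a h ha
      · exact hM1 e he f hf hne a ha
    · rintro e (rfl | he) a ha
      · rcases Sym2.mem_iff.1 ha with rfl | rfl
        exacts [hx.1, hx'.1]
      · exact hM3 e he a ha

end Cubic

/-- A minimal counterexample has no vertex of degree 2: it is 3-regular. -/
theorem minCounter_three_regular {V : Type} [Finite V] (G : SimpleGraph V)
    (hG : MinCounter V G) :
    ∀ v : V, (G.neighborSet v).ncard = 3 := by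
  intro v
  have hdeg : ∀ z, (G.neighborSet z).ncard = 2 ∨ (G.neighborSet z).ncard = 3 := by
    intro z
    have h1 := hG.two_le_ncard_neighborSet z
    have h2 := hG.1 z
    omega
  refine (hdeg v).resolve_left fun hv => ?_
  obtain ⟨M, hM⟩ := hG.exists_isCubicMatching hdeg hv
  obtain ⟨c, hc⟩ := hM.exists_partialGood (hG.connected v) hdeg hv
  exact hG.not_partialGood c hc
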